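/- arXiv:1501.02708 — 4 statements merged into one kernel-verified Lean document; each statement's English description precedes it below -/
import Mathlib

section
/- Let U be a complex permutation matrix indexed by Fin d_A × Fin d_B (d_A, d_B ≥ 1). Then U = U_1 U_2 U_3 where U_1 and U_3 are controlled-complex-permutation matrices from the A side in the computational basis and U_2 is a controlled-complex-permutation matrix from the B side in the computational basis. -/
open Matrix BigOperators

/-- A complex permutation matrix: a unitary with exactly one nonzero entry in each row
and each column. -/
def IsCPermMatrix {n : Type*} [Fintype n] [DecidableEq n] (M : Matrix n n ℂ) : Prop :=
  M ∈ Matrix.unitaryGroup n ℂ ∧ (∀ i, ∃! j, M i j ≠ 0) ∧ (∀ j, ∃! i, M i j ≠ 0)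

/-- A controlled-complex-permutation matrix from the A side in the computational basis:
`∑_j |j⟩⟨j| ⊗ P_j` with each `P_j` a complex permutation matrix. -/
def CtrlCPermA {dA dB : ℕ} (U : Matrix (Fin dA × Fin dB) (Fin dA × Fin dB) ℂ) : Prop :=
  ∃ P : Fin dA → Matrix (Fin dB) (Fin dB) ℂ, (∀ j, IsCPermMatrix (P j)) ∧
    ∀ p q : Fin dA × Fin dB, U p q = if p.1 = q.1 then P p.1 p.2 q.2 else 0

/-- A controlled-complex-permutation matrix from the B side in the computational basis:
`∑_k Q_k ⊗ |k⟩⟨k|` with each `Q_k` a complex permutation matrix. -/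
def CtrlCPermB {dA dB : ℕ} (U : Matrix (Fin dA × Fin dB) (Fin dA × Fin dB) ℂ) : Prop :=
  ∃ Q : Fin dB → Matrix (Fin dA) (Fin dA) ℂ, (∀ k, IsCPermMatrix (Q k)) ∧
    ∀ p q : Fin dA × Fin dB, U p q = if p.2 = q.2 then Q p.2 p.1 q.1 else 0

/-- In a bipartite multigraph with edge set `S` that is regular of positive degree, there is a
perfect matching. -/
theorem exists_matching_of_regular {E A : Type*} [DecidableEq A]
    (s t : E → A) (S : Finset E) (n : ℕ) (hn : 0 < n)
    (hs : ∀ a, (S.filter fun e => s e = a).card = n)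
    (ht : ∀ a, (S.filter fun e => t e = a).card = n) :
    ∃ g : A → E, (∀ a, g a ∈ S) ∧ (∀ a, s (g a) = a) ∧ Function.Injective (t ∘ g) := by
  obtain ⟨f, hf, hfm⟩ := (Finset.all_card_le_biUnion_card_iff_exists_injective
    fun a => (S.filter fun e => s e = a).image t).1 fun X => by
      set N := X.biUnion fun a => (S.filter fun e => s e = a).image t
      have card_over (u : E → A) (hu : ∀ a, (S.filter fun e => u e = a).card = n)
          (Y : Finset A) : (S.filter fun e => u e ∈ Y).card = Y.card * n := by
        have hmaps : ∀ e ∈ S.filter fun e => u e ∈ Y, u e ∈ Y :=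
          fun e he => (Finset.mem_filter.1 he).2
        rw [Finset.card_eq_sum_card_fiberwise hmaps]
        refine Finset.sum_const_nat fun a ha => ?_
        rw [← hu a, Finset.filter_filter]
        congr 1
        refine Finset.filter_congr fun e _ => ?_
        exact ⟨fun h => h.2, fun h => ⟨h ▸ ha, h⟩⟩
      have hsub : (S.filter fun e => s e ∈ X) ⊆ S.filter fun e => t e ∈ N := by
        intro e he
        simp only [Finset.mem_filter] at he ⊢
        refine ⟨he.1, Finset.mem_biUnion.2 ⟨s e, he.2, Finset.mem_image_of_mem t ?_⟩⟩
        simp [he.1]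
      have hle := Finset.card_le_card hsub
      rw [card_over s hs, card_over t ht] at hle
      exact Nat.le_of_mul_le_mul_right hle hn
  have hex (a : A) : ∃ e ∈ S, s e = a ∧ t e = f a := by
    simpa [and_assoc] using hfm a
  choose g hgS hgs hgt using hex
  refine ⟨g, hgS, hgs, fun a b hab => hf ?_⟩
  simpa [hgt] using hab

/-- A bipartite multigraph that is regular of degree `n` has a proper edge colouring with `n`
colours. -/
theorem exists_edge_coloring_of_regular {E A : Type*} [Fintype A] [DecidableEq A]
    (s t : E → A) (n : ℕ) (S : Finset E)
    (hs : ∀ a, (S.filter fun e => s e = a).card = n)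
    (ht : ∀ a, (S.filter fun e => t e = a).card = n) :
    ∃ c : E → ℕ, (∀ e ∈ S, c e < n) ∧
      (∀ e ∈ S, ∀ e' ∈ S, s e = s e' → c e = c e' → e = e') ∧
      (∀ e ∈ S, ∀ e' ∈ S, t e = t e' → c e = c e' → e = e') := by
  classical
  induction n generalizing S with
  | zero =>
    have hempty (e : E) : e ∉ S := fun he => by
      have := Finset.card_eq_zero.1 (hs (s e))
      exact Finset.notMem_empty e (this ▸ Finset.mem_filter.2 ⟨he, rfl⟩)
    exact ⟨fun _ => 0, fun e he => absurd he (hempty e), fun e he => absurd he (hempty e),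
      fun e he => absurd he (hempty e)⟩
  | succ n ih =>
    obtain ⟨g, hgS, hgs, hgt⟩ := exists_matching_of_regular s t S (n + 1) n.succ_pos hs ht
    have hgt_surj : Function.Surjective (t ∘ g) := Finite.surjective_of_injective hgt
    set M := Finset.univ.image g with hM
    have mem_M {e : E} : e ∈ M ↔ ∃ a, g a = e := by simp [hM]
    have hMs : ∀ e ∈ M, ∀ e' ∈ M, s e = s e' → e = e' := by
      simp only [mem_M]
      rintro _ ⟨a, rfl⟩ _ ⟨b, rfl⟩ h
      rw [hgs, hgs] at h
      rw [h]
    have hMt : ∀ e ∈ M, ∀ e' ∈ M, t e = t e' → e = e' := by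
      simp only [mem_M]
      rintro _ ⟨a, rfl⟩ _ ⟨b, rfl⟩ h
      rw [hgt h]
    have card_sdiff (u : E → A) (hu : ∀ a, (S.filter fun e => u e = a).card = n + 1)
        (hinj : ∀ e ∈ M, ∀ e' ∈ M, u e = u e' → e = e') (hsurj : ∀ a, ∃ e ∈ M, u e = a)
        (a : A) : ((S \ M).filter fun e => u e = a).card = n := by
      obtain ⟨m, hm, rfl⟩ := hsurj a
      have hmS : m ∈ S := by
        obtain ⟨b, rfl⟩ := mem_M.1 hm
        exact hgS b
      have heq : (S \ M).filter (fun e => u e = u m) =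
          (S.filter fun e => u e = u m).erase m := by
        ext e
        simp only [Finset.mem_filter, Finset.mem_sdiff, Finset.mem_erase]
        constructor
        · rintro ⟨⟨h1, h2⟩, h3⟩
          exact ⟨fun h => h2 (h ▸ hm), h1, h3⟩
        · rintro ⟨h1, h2, h3⟩
          exact ⟨⟨h2, fun h => h1 (hinj e h m hm h3)⟩, h3⟩
      rw [heq, Finset.card_erase_of_mem (by simp [hmS]), hu, Nat.add_sub_cancel]
    obtain ⟨c, hc, hcs, hct⟩ := ih (S \ M)
      (card_sdiff s hs hMs fun a => ⟨g a, mem_M.2 ⟨a, rfl⟩, hgs a⟩)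
      (card_sdiff t ht hMt fun a => by
        obtain ⟨b, hb⟩ := hgt_surj a
        exact ⟨g b, mem_M.2 ⟨b, rfl⟩, hb⟩)
    have extend (u : E → A) (hinj : ∀ e ∈ M, ∀ e' ∈ M, u e = u e' → e = e')
        (hcu : ∀ e ∈ S \ M, ∀ e' ∈ S \ M, u e = u e' → c e = c e' → e = e') :
        ∀ e ∈ S, ∀ e' ∈ S, u e = u e' →
          (if e ∈ M then n else c e) = (if e' ∈ M then n else c e') → e = e' := by
      intro e he e' he' hu h
      by_cases h1 : e ∈ M <;> by_cases h2 : e' ∈ M <;> simp only [h1, h2, if_true, if_false] at h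
      · exact hinj e h1 e' h2 hu
      · exact absurd h (hc e' (Finset.mem_sdiff.2 ⟨he', h2⟩)).ne'
      · exact absurd h (hc e (Finset.mem_sdiff.2 ⟨he, h1⟩)).ne
      · exact hcu e (Finset.mem_sdiff.2 ⟨he, h1⟩) e' (Finset.mem_sdiff.2 ⟨he', h2⟩) hu h
    refine ⟨fun e => if e ∈ M then n else c e, fun e he => ?_, extend s hMs hcs, extend t hMt hct⟩
    by_cases h : e ∈ M
    · simp [h]
    · simpa [h] using (hc e (Finset.mem_sdiff.2 ⟨he, h⟩)).trans n.lt_succ_self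

/-- A permutation of `A × B` factors as a permutation preserving the first coordinate, one
preserving the second, and one preserving the first. -/
theorem Equiv.Perm.exists_three_factors {A B : Type*} [Fintype A] [Fintype B]
    (σ : Equiv.Perm (A × B)) :
    ∃ α β γ : Equiv.Perm (A × B), (∀ p, (α p).1 = p.1) ∧ (∀ p, (β p).2 = p.2) ∧
      (∀ p, (γ p).1 = p.1) ∧ ∀ p, γ (β (α p)) = σ p := by
  classical
  have hfst (a : A) :
      ((Finset.univ : Finset (A × B)).filter fun p => p.1 = a).card = Fintype.card B := by
    have : ((Finset.univ : Finset (A × B)).filter fun p => p.1 = a) = {a} ×ˢ Finset.univ := by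
      ext ⟨a', b⟩
      simp [eq_comm]
    rw [this]
    simp
  have hσ (a : A) :
      ((Finset.univ : Finset (A × B)).filter fun p => (σ p).1 = a).card = Fintype.card B := by
    rw [← hfst a]
    exact Finset.card_equiv σ (by simp)
  obtain ⟨c, hc, hcs, hct⟩ := exists_edge_coloring_of_regular (fun p : A × B => p.1)
    (fun p => (σ p).1) (Fintype.card B) Finset.univ hfst hσ
  let k (p : A × B) : B := (Fintype.equivFin B).symm ⟨c p, hc p (Finset.mem_univ p)⟩
  have hk {p q : A × B} (h : k p = k q) : c p = c q := by simpa [k] using h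
  have hα : Function.Injective fun p : A × B => (p.1, k p) := fun p q h =>
    hcs p (Finset.mem_univ p) q (Finset.mem_univ q) (Prod.mk.inj h).1
      (hk (Prod.mk.inj h).2)
  have hδ : Function.Injective fun p : A × B => ((σ p).1, k p) := fun p q h =>
    hct p (Finset.mem_univ p) q (Finset.mem_univ q) (Prod.mk.inj h).1
      (hk (Prod.mk.inj h).2)
  let α : Equiv.Perm (A × B) := Equiv.ofBijective _ (Finite.injective_iff_bijective.1 hα)
  let δ : Equiv.Perm (A × B) := Equiv.ofBijective _ (Finite.injective_iff_bijective.1 hδ)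
  refine ⟨α, α.symm.trans δ, δ.symm.trans σ, fun p => rfl, fun p => ?_, fun p => ?_, fun p => ?_⟩
  · obtain ⟨q, rfl⟩ := α.surjective p
    rw [Equiv.trans_apply, Equiv.symm_apply_apply]
    rfl
  · obtain ⟨q, rfl⟩ := δ.surjective p
    rw [Equiv.trans_apply, Equiv.symm_apply_apply]
    rfl
  · simp

/-- The matrix with entry `d i` at `(i, σ i)` and zeros elsewhere. -/
def monomialMatrix {n : Type*} [DecidableEq n] (σ : Equiv.Perm n) (d : n → ℂ) :
    Matrix n n ℂ :=
  Matrix.of fun i j => if σ i = j then d i else 0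

theorem monomialMatrix_apply {n : Type*} [DecidableEq n] (σ : Equiv.Perm n) (d : n → ℂ)
    (i j : n) : monomialMatrix σ d i j = if σ i = j then d i else 0 := rfl

theorem monomialMatrix_mul {n : Type*} [Fintype n] [DecidableEq n] (σ τ : Equiv.Perm n)
    (d e : n → ℂ) :
    monomialMatrix σ d * monomialMatrix τ e =
      monomialMatrix (σ.trans τ) fun i => d i * e (σ i) := by
  ext i j
  simp only [Matrix.mul_apply, monomialMatrix_apply, ite_mul, zero_mul, Finset.sum_ite_eq,
    Finset.mem_univ, if_true, Equiv.trans_apply]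
  rw [mul_ite, mul_zero]
  rfl

theorem isCPermMatrix_monomialMatrix {n : Type*} [Fintype n] [DecidableEq n]
    (σ : Equiv.Perm n) (d : n → ℂ) (hd : ∀ i, d i * star (d i) = 1) :
    IsCPermMatrix (monomialMatrix σ d) := by
  have hd0 (i : n) : d i ≠ 0 := left_ne_zero_of_mul_eq_one (hd i)
  refine ⟨Matrix.mem_unitaryGroup_iff.2 ?_, fun i => ⟨σ i, ?_, ?_⟩, fun j => ⟨σ.symm j, ?_, ?_⟩⟩
  · ext i j
    rw [Matrix.mul_apply]
    simp only [Matrix.star_apply, monomialMatrix_apply, ite_mul, zero_mul, Finset.sum_ite_eq,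
      Finset.mem_univ, if_true, Matrix.one_apply, σ.apply_eq_iff_eq, eq_comm (a := j)]
    split_ifs with h
    · rw [← h, hd]
    · simp
  · simp [monomialMatrix_apply, hd0]
  · simp +contextual [monomialMatrix_apply]
  · simp [monomialMatrix_apply, hd0]
  · simp +contextual [monomialMatrix_apply, Equiv.eq_symm_apply]

theorem IsCPermMatrix.exists_eq_monomialMatrix {n : Type*} [Fintype n] [DecidableEq n]
    {M : Matrix n n ℂ} (hM : IsCPermMatrix M) :
    ∃ (σ : Equiv.Perm n) (d : n → ℂ), (∀ i, d i * star (d i) = 1) ∧ M = monomialMatrix σ d := by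
  obtain ⟨hU, hrow, hcol⟩ := hM
  choose f hf hf' using hrow
  have hinj : Function.Injective f := fun i i' h =>
    (hcol (f i)).unique (hf i) (h ▸ hf i')
  have hzero {i j : n} (h : f i ≠ j) : M i j = 0 := by
    by_contra h0
    exact h (hf' i j h0).symm
  refine ⟨Equiv.ofBijective f (Finite.injective_iff_bijective.1 hinj), fun i => M i (f i),
    fun i => ?_, ?_⟩
  · have h := congrFun (congrFun (Matrix.mem_unitaryGroup_iff.1 hU) i) i
    rw [Matrix.mul_apply, Finset.sum_eq_single (f i)] at h
    · simpa using h
    · intro j _ hj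
      rw [hzero hj.symm, zero_mul]
    · simp
  · ext i j
    rw [monomialMatrix_apply, Equiv.ofBijective_apply]
    split_ifs with h
    · rw [h]
    · exact hzero h

theorem ctrlCPermA_monomialMatrix {dA dB : ℕ} (σ : Equiv.Perm (Fin dA × Fin dB))
    (d : Fin dA × Fin dB → ℂ) (hσ : ∀ p, (σ p).1 = p.1) (hd : ∀ p, d p * star (d p) = 1) :
    CtrlCPermA (monomialMatrix σ d) := by
  have hinj (j : Fin dA) : Function.Injective fun k => (σ (j, k)).2 := fun k k' h => by
    have : σ (j, k) = σ (j, k') := Prod.ext (by rw [hσ, hσ]) h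
    simpa using this
  refine ⟨fun j => monomialMatrix
    (Equiv.ofBijective _ (Finite.injective_iff_bijective.1 (hinj j))) fun k => d (j, k),
    fun j => isCPermMatrix_monomialMatrix _ _ fun k => hd (j, k), fun p q => ?_⟩
  simp only [monomialMatrix_apply, Equiv.ofBijective_apply, Prod.ext_iff, hσ, ite_and]

theorem ctrlCPermB_monomialMatrix {dA dB : ℕ} (σ : Equiv.Perm (Fin dA × Fin dB))
    (d : Fin dA × Fin dB → ℂ) (hσ : ∀ p, (σ p).2 = p.2) (hd : ∀ p, d p * star (d p) = 1) :
    CtrlCPermB (monomialMatrix σ d) := by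
  have hinj (k : Fin dB) : Function.Injective fun j => (σ (j, k)).1 := fun j j' h => by
    have : σ (j, k) = σ (j', k) := Prod.ext h (by rw [hσ, hσ])
    simpa using this
  refine ⟨fun k => monomialMatrix
    (Equiv.ofBijective _ (Finite.injective_iff_bijective.1 (hinj k))) fun j => d (j, k),
    fun k => isCPermMatrix_monomialMatrix _ _ fun j => hd (j, k), fun p q => ?_⟩
  simp only [monomialMatrix_apply, Equiv.ofBijective_apply, Prod.ext_iff, hσ,
    and_comm (b := p.2 = q.2), ite_and]

/-- Every bipartite complex permutation matrix is the product of three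
controlled-complex-permutation matrices, controlled from the A, B and A sides. -/
theorem cperm_three_ctrlCPerm (dA dB : ℕ) (hdA : 1 ≤ dA) (hdB : 1 ≤ dB)
    (U : Matrix (Fin dA × Fin dB) (Fin dA × Fin dB) ℂ) (hU : IsCPermMatrix U) :
    ∃ U₁ U₂ U₃ : Matrix (Fin dA × Fin dB) (Fin dA × Fin dB) ℂ,
      CtrlCPermA U₁ ∧ CtrlCPermB U₂ ∧ CtrlCPermA U₃ ∧ U = U₁ * U₂ * U₃ := by
  obtain ⟨σ, d, hd, rfl⟩ := hU.exists_eq_monomialMatrix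
  obtain ⟨α, β, γ, hα, hβ, hγ, hσ⟩ := σ.exists_three_factors
  refine ⟨monomialMatrix α d, monomialMatrix β 1, monomialMatrix γ 1,
    ctrlCPermA_monomialMatrix α d hα hd, ctrlCPermB_monomialMatrix β 1 hβ (by simp),
    ctrlCPermA_monomialMatrix γ 1 hγ (by simp), ?_⟩
  rw [monomialMatrix_mul, monomialMatrix_mul]
  ext p q
  simp [monomialMatrix_apply, hσ]
end

section
/- Let n ≥ 1 and let d : Fin n → ℕ with d_j ≥ 2 for every j. Every unitary on ℂ^{d_1} ⊗ ⋯ ⊗ ℂ^{d_n} (a unitary matrix indexed by Π_{j : Fin n} Fin (d j)) is the product of at most 2·∏_{j=1}^{n−1}(2·d_j − 2) − 1 unitaries, each of which is controlled in the computational basis with some target party t (i.e., each factor G satisfies G_{x,y} = 0 whenever x_j ≠ y_j for some j ≠ t). -/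
open Matrix BigOperators

/-- An `n`-partite unitary is controlled in the computational basis with target party `t`
if its entry vanishes whenever the row and column indices differ at some party `j ≠ t`. -/
def CtrlTarget {n : ℕ} {d : Fin n → ℕ} (t : Fin n)
    (G : Matrix (∀ j, Fin (d j)) (∀ j, Fin (d j)) ℂ) : Prop :=
  ∀ x y : ∀ j, Fin (d j), (∃ j, j ≠ t ∧ x j ≠ y j) → G x y = 0

theorem exists_unitary_rows {κ ι : Type*} [Fintype κ] [DecidableEq κ] [Fintype ι] [DecidableEq ι]
    (T : Matrix κ ι ℂ) (μ : κ → ℂ) (hT : T * Tᴴ = diagonal μ) (e : κ ↪ ι) :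
    ∃ V ∈ unitaryGroup ι ℂ, ∃ w : κ → ℝ,
      (∀ k, (w k : ℂ) ^ 2 = μ k) ∧ ∀ k i, T k i = w k * V (e k) i := by
  set t : κ → EuclideanSpace ℂ ι := fun k => WithLp.toLp 2 (T k) with ht
  have hinner (k l : κ) : inner ℂ (t l) (t k) = diagonal μ k l := by
    rw [← hT, EuclideanSpace.inner_eq_star_dotProduct]
    simp [ht, Matrix.mul_apply, dotProduct]
  have horth : Orthonormal ℂ ((e '' {k | t k ≠ 0}).domRestrict
      (Function.extend e (fun k => ((‖t k‖⁻¹ : ℝ) : ℂ) • t k) 0)) := by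
    constructor
    · rintro ⟨_, k, hk, rfl⟩
      have hk' : ‖t k‖ ≠ 0 := norm_ne_zero_iff.mpr hk
      simp [Set.domRestrict_apply, e.injective.extend_apply, norm_smul, hk']
    · rintro ⟨_, k, hk, rfl⟩ ⟨_, l, hl, rfl⟩ hkl
      have hne : l ≠ k := by
        rintro rfl
        exact hkl rfl
      simp [Set.domRestrict_apply, e.injective.extend_apply, inner_smul_left, inner_smul_right,
        hinner, hne]
  obtain ⟨b, hb⟩ := horth.exists_orthonormalBasis_extension_of_card_eq (by simp)
  refine ⟨Matrix.of fun i j => b i j, ?_, fun k => ‖t k‖, fun k => ?_, fun k i => ?_⟩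
  · rw [mem_unitaryGroup_iff]
    ext i j
    have h := orthonormal_iff_ite.mp b.orthonormal j i
    rw [EuclideanSpace.inner_eq_star_dotProduct] at h
    simpa [Matrix.mul_apply, dotProduct, Matrix.one_apply, eq_comm, star_apply] using h
  · have h := hinner k k
    rw [inner_self_eq_norm_sq_to_K] at h
    simpa using h
  · by_cases hk : t k = 0
    · have : T k i = (t k) i := rfl
      rw [this]
      simp [hk]
    · have hk' : (‖t k‖ : ℂ) ≠ 0 := by exact_mod_cast norm_ne_zero_iff.mpr hk
      have h := hb (e k) ⟨k, hk, rfl⟩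
      rw [e.injective.extend_apply] at h
      have : T k i = (t k) i := rfl
      simp only [Matrix.of_apply, h]
      rw [this]
      simp [hk']

/-- The direct sum of planar rotations with cosines `c` and sines `s`, acting on the orbits of `σ`. -/
def pairRotation {X : Type*} [DecidableEq X] (σ : X → X) (c s : X → ℝ) : Matrix X X ℂ :=
  Matrix.of fun x y => (if x = y then (c x : ℂ) else 0) + if σ x = y then (s x : ℂ) else 0

theorem pairRotation_mem_unitaryGroup {X : Type*} [Fintype X] [DecidableEq X] {σ : X → X}
    (hσ : Function.Involutive σ) {c s : X → ℝ} (hc : ∀ x, c (σ x) = c x)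
    (hs : ∀ x, s (σ x) = -s x) (hcs : ∀ x, c x ^ 2 + s x ^ 2 = 1) :
    pairRotation σ c s ∈ unitaryGroup X ℂ := by
  rw [mem_unitaryGroup_iff]
  ext x z
  have hcs' : (c x : ℂ) * c x + s x * s x = 1 := by
    have := hcs x
    exact_mod_cast (by linarith [sq (c x), sq (s x)] : c x * c x + s x * s x = 1)
  have hinj : σ z = σ x ↔ x = z := ⟨fun h => (hσ.injective h).symm, fun h => h ▸ rfl⟩
  simp only [pairRotation, Matrix.mul_apply, star_apply, Matrix.of_apply, star_add, add_mul,
    ite_mul, zero_mul, Finset.sum_add_distrib, Finset.sum_ite_eq, Finset.mem_univ, if_true,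
    Matrix.one_apply]
  by_cases hxz : x = z
  · subst hxz
    by_cases hx : σ x = x
    · have : s x = 0 := by
        have := hs x
        rw [hx] at this
        linarith
      simpa [hx, this] using hcs'
    · have hx' : x ≠ σ x := fun h => hx h.symm
      simpa [hx, hx'] using hcs'
  · by_cases hx : σ x = z
    · have hz : σ z = x := by rw [← hx, hσ]
      subst hx
      have h1 : ¬ σ x = x := fun h => hxz h.symm
      simp [hxz, hz, hc, hs, h1]
      ring
    · have hz : ¬ σ z = x := by
        rintro rfl
        exact hx (hσ z)
      have hz' : ¬ z = x := fun h => hxz h.symm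
      have hz'' : ¬ z = σ x := fun h => hx h.symm
      simp [hxz, hz, hinj, hz', hz'']

theorem exists_cosine_sine_sum {ι κ : Type*} [Fintype κ] [DecidableEq κ] [Fintype ι]
    [DecidableEq ι] {σ : ι ⊕ κ → ι ⊕ κ} (hσ : Function.Involutive σ) (e : κ ↪ ι)
    (hσe : ∀ k, σ (Sum.inr k) = Sum.inl (e k)) {U : Matrix (ι ⊕ κ) (ι ⊕ κ) ℂ}
    (hU : U ∈ unitaryGroup (ι ⊕ κ) ℂ) :
    ∃ A ∈ unitaryGroup (ι ⊕ κ) ℂ, ∃ C ∈ unitaryGroup (ι ⊕ κ) ℂ,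
      ∃ B ∈ unitaryGroup (ι ⊕ κ) ℂ, U = A * C * B ∧
        (∀ x y, x.isLeft ≠ y.isLeft → A x y = 0) ∧
        (∀ x y, x ≠ y → σ x ≠ y → C x y = 0) ∧
        (∀ x y, x.isLeft ≠ y.isLeft → B x y = 0) := by
  set R := U.toBlocks₂₁
  set S := U.toBlocks₂₂
  have hRS : R * Rᴴ + S * Sᴴ = 1 := by
    have h := mem_unitaryGroup_iff.mp hU
    rw [star_eq_conjTranspose, ← fromBlocks_toBlocks U, fromBlocks_conjTranspose,
      fromBlocks_multiply, ← fromBlocks_one] at h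
    exact (fromBlocks_inj.mp h).2.2.2
  have hH := isHermitian_mul_conjTranspose_self S
  obtain ⟨E, hEu, μ, hE⟩ : ∃ E ∈ unitaryGroup κ ℂ, ∃ μ : κ → ℂ, S * Sᴴ = E * diagonal μ * Eᴴ :=
    ⟨_, hH.eigenvectorUnitary.2, _, hH.spectral_theorem⟩
  have hEl : Eᴴ * E = 1 := mem_unitaryGroup_iff'.mp hEu
  have hEr : E * Eᴴ = 1 := mem_unitaryGroup_iff.mp hEu
  have hμ : Eᴴ * (S * Sᴴ) * E = diagonal μ := by
    rw [hE]
    simp only [Matrix.mul_assoc, hEl, Matrix.mul_one]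
    rw [← Matrix.mul_assoc, hEl, Matrix.one_mul]
  obtain ⟨V₂, hV₂, c, hc, hcV⟩ := exists_unitary_rows (Eᴴ * S) μ
    (by rw [← hμ, conjTranspose_mul, conjTranspose_conjTranspose]; simp only [Matrix.mul_assoc])
    (Function.Embedding.refl κ)
  obtain ⟨V₁, hV₁, s, hs, hsV⟩ := exists_unitary_rows (Eᴴ * R) (1 - μ)
    (by
      have h : R * Rᴴ = 1 - S * Sᴴ := eq_sub_of_add_eq hRS
      calc (Eᴴ * R) * (Eᴴ * R)ᴴ = Eᴴ * (R * Rᴴ) * E := by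
            rw [conjTranspose_mul, conjTranspose_conjTranspose]; simp only [Matrix.mul_assoc]
        _ = 1 - diagonal μ := by
            rw [h, Matrix.mul_sub, Matrix.sub_mul, hμ, Matrix.mul_one, hEl]
        _ = diagonal (1 - μ) := by rw [← diagonal_one, diagonal_sub]; rfl) e
  have hcs (k : κ) : c k ^ 2 + s k ^ 2 = 1 := by
    have : (c k : ℂ) ^ 2 + (s k : ℂ) ^ 2 = 1 := by rw [hc, hs]; simp
    exact_mod_cast this
  set c' : ι ⊕ κ → ℝ := fun x => Sum.elim (fun _ => Sum.elim (fun _ => 1) c (σ x)) c x with hc'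
  set s' : ι ⊕ κ → ℝ :=
    fun x => Sum.elim (fun _ => Sum.elim (fun _ => 0) (fun k => -s k) (σ x)) s x with hs'
  have hC : pairRotation σ c' s' ∈ unitaryGroup (ι ⊕ κ) ℂ := by
    refine pairRotation_mem_unitaryGroup hσ ?_ ?_ ?_
    · intro x
      rcases x with i | k
      · rcases h : σ (Sum.inl i) with j | k
        · have h' : σ (Sum.inl j) = Sum.inl i := by rw [← h, hσ]
          simp [hc', h, h']
        · simp [hc', h]
      · have h' : σ (Sum.inl (e k)) = Sum.inr k := by rw [← hσe, hσ]
        simp [hc', hσe, h']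
    · intro x
      rcases x with i | k
      · rcases h : σ (Sum.inl i) with j | k
        · have h' : σ (Sum.inl j) = Sum.inl i := by rw [← h, hσ]
          simp [hs', h, h']
        · simp [hs', h]
      · have h' : σ (Sum.inl (e k)) = Sum.inr k := by rw [← hσe, hσ]
        simp [hs', hσe, h']
    · intro x
      rcases x with i | k
      · rcases h : σ (Sum.inl i) with j | k <;> simp [hs', hc', h, hcs]
      · simp [hs', hc', hcs]
  have hB : fromBlocks V₁ 0 0 V₂ ∈ unitaryGroup (ι ⊕ κ) ℂ := by
    rw [mem_unitaryGroup_iff, star_eq_conjTranspose] at *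
    simp [fromBlocks_conjTranspose, fromBlocks_multiply, hV₁, hV₂]
  set B := fromBlocks V₁ 0 0 V₂ with hBdef
  set C := pairRotation σ c' s' with hCdef
  have hN := mul_mem hC hB
  have hrow (k : κ) (y) :
      (C * B) (Sum.inr k) y = (Eᴴ * (Matrix.of fun k y => U (Sum.inr k) y)) k y := by
    have h1 : (C * B) (Sum.inr k) y = c k * B (Sum.inr k) y + s k * B (Sum.inl (e k)) y := by
      simp [hCdef, pairRotation, Matrix.mul_apply, add_mul, Finset.sum_add_distrib, hσe, hc', hs']
    rw [h1]
    rcases y with i | l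
    · have := hsV k i
      simp [hBdef, ← this]
      rfl
    · have := hcV k l
      simp at this
      simp [hBdef, ← this]
      rfl
  set N := C * B with hNdef
  have hNN : N * Nᴴ = 1 := mem_unitaryGroup_iff.mp hN
  have hNN' : Nᴴ * N = 1 := mem_unitaryGroup_iff'.mp hN
  have hAu : U * Nᴴ ∈ unitaryGroup (ι ⊕ κ) ℂ := mul_mem hU (Unitary.star_mem hN)
  set F : Matrix κ (ι ⊕ κ) ℂ := Matrix.of fun k y => U (Sum.inr k) y with hF
  have hFN : F = E * (Matrix.of fun k y => N (Sum.inr k) y) := by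
    have : (Matrix.of fun k y => N (Sum.inr k) y) = Eᴴ * F := by ext k y; exact hrow k y
    rw [this, ← Matrix.mul_assoc, hEr, Matrix.one_mul]
  have hArow (k : κ) (x) : (U * Nᴴ) (Sum.inr k) x = Sum.elim (fun _ => 0) (E k) x := by
    have h1 : (U * Nᴴ) (Sum.inr k) x = (F * Nᴴ) k x := rfl
    have h2 (l : κ) : ((Matrix.of fun k y => N (Sum.inr k) y) * Nᴴ : Matrix κ (ι ⊕ κ) ℂ) l x
        = (1 : Matrix (ι ⊕ κ) (ι ⊕ κ) ℂ) (Sum.inr l) x := by rw [← hNN]; rfl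
    rw [h1, hFN, Matrix.mul_assoc, Matrix.mul_apply]
    simp only [h2]
    rcases x with i | l <;> simp [Matrix.one_apply]
  have hA21 : (U * Nᴴ).toBlocks₂₁ = 0 := by ext k i; exact hArow k (Sum.inl i)
  have hA22 : (U * Nᴴ).toBlocks₂₂ = E := by ext k i; exact hArow k (Sum.inr i)
  have hA12 : (U * Nᴴ).toBlocks₁₂ = 0 := by
    have h := mem_unitaryGroup_iff.mp hAu
    rw [star_eq_conjTranspose, ← fromBlocks_toBlocks (U * Nᴴ), fromBlocks_conjTranspose,
      fromBlocks_multiply, ← fromBlocks_one] at h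
    have h' := (fromBlocks_inj.mp h).2.1
    rw [hA21, hA22, conjTranspose_zero, Matrix.mul_zero, zero_add] at h'
    calc (U * Nᴴ).toBlocks₁₂ = (U * Nᴴ).toBlocks₁₂ * Eᴴ * E := by
          rw [Matrix.mul_assoc, hEl, Matrix.mul_one]
      _ = 0 := by rw [h', Matrix.zero_mul]
  refine ⟨U * Nᴴ, hAu, C, hC, B, hB, ?_, ?_, ?_, ?_⟩
  · rw [Matrix.mul_assoc, ← hNdef, Matrix.mul_assoc, hNN', Matrix.mul_one]
  · rintro (i | k) (j | l) h
    · simp at h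
    · exact congrFun (congrFun hA12 i) l
    · exact congrFun (congrFun hA21 k) j
    · simp at h
  · intro x y h1 h2
    simp [hCdef, pairRotation, h1, h2]
  · rintro (i | k) (j | l) h <;> simp [hBdef] at h ⊢

theorem submatrix_mem_unitaryGroup {X Y : Type*} [Fintype X] [DecidableEq X] [Fintype Y]
    [DecidableEq Y] {U : Matrix X X ℂ} (hU : U ∈ unitaryGroup X ℂ) (f : Y ≃ X) :
    U.submatrix f f ∈ unitaryGroup Y ℂ := by
  rw [mem_unitaryGroup_iff, star_eq_conjTranspose] at *
  rw [conjTranspose_submatrix, submatrix_mul_equiv, hU, submatrix_one_equiv]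

theorem exists_cosine_sine {X : Type*} [Fintype X] [DecidableEq X] (q : X → Prop)
    [DecidablePred q] {σ : X → X} (hσ : Function.Involutive σ) (hσq : ∀ x, ¬ q x → q (σ x))
    {U : Matrix X X ℂ} (hU : U ∈ unitaryGroup X ℂ) :
    ∃ A ∈ unitaryGroup X ℂ, ∃ C ∈ unitaryGroup X ℂ, ∃ B ∈ unitaryGroup X ℂ, U = A * C * B ∧
      (∀ x y, ¬ (q x ↔ q y) → A x y = 0) ∧
      (∀ x y, x ≠ y → σ x ≠ y → C x y = 0) ∧
      (∀ x y, ¬ (q x ↔ q y) → B x y = 0) := by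
  set f := Equiv.sumCompl q with hf
  have hleft (x : X) : (f.symm x).isLeft = decide (q x) := by
    by_cases hx : q x
    · simp [hf, Equiv.sumCompl_symm_apply_of_pos hx, hx]
    · simp [hf, Equiv.sumCompl_symm_apply_of_neg hx, hx]
  obtain ⟨A, hA, C, hC, B, hB, h, hA', hC', hB'⟩ := exists_cosine_sine_sum
    (σ := fun x => f.symm (σ (f x))) (fun x => by simp [hσ _])
    ⟨fun k : {x // ¬ q x} => (⟨σ k, hσq k k.2⟩ : {x // q x}),
      fun k l h => Subtype.ext (hσ.injective (congrArg Subtype.val h))⟩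
    (fun k => by
      rw [Equiv.symm_apply_eq]
      rfl)
    (submatrix_mem_unitaryGroup hU f)
  refine ⟨_, submatrix_mem_unitaryGroup hA f.symm, _, submatrix_mem_unitaryGroup hC f.symm,
    _, submatrix_mem_unitaryGroup hB f.symm, ?_, fun x y hxy => hA' _ _ ?_,
    fun x y h1 h2 => hC' _ _ ?_ ?_, fun x y hxy => hB' _ _ ?_⟩
  · rw [submatrix_mul_equiv, submatrix_mul_equiv, ← h]
    simp
  · rw [hleft, hleft]
    simpa using hxy
  · simpa using h1
  · simpa using h2
  · rw [hleft, hleft]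
    simpa using hxy

theorem exists_cosine_sine_of_blocks {X L : Type*} [Fintype X] [DecidableEq X] [Fintype L]
    [DecidableEq L] (p : X → L) (q : X → Prop) [DecidablePred q] {σ : X → X}
    (hσ : Function.Involutive σ) (hσp : ∀ x, p (σ x) = p x) (hσq : ∀ x, ¬ q x → q (σ x))
    {U : Matrix X X ℂ} (hU : U ∈ unitaryGroup X ℂ) (hUp : ∀ x y, p x ≠ p y → U x y = 0) :
    ∃ A ∈ unitaryGroup X ℂ, ∃ C ∈ unitaryGroup X ℂ, ∃ B ∈ unitaryGroup X ℂ, U = A * C * B ∧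
      (∀ x y, ¬ (p x = p y ∧ (q x ↔ q y)) → A x y = 0) ∧
      (∀ x y, x ≠ y → σ x ≠ y → C x y = 0) ∧
      (∀ x y, ¬ (p x = p y ∧ (q x ↔ q y)) → B x y = 0) := by
  set f := Equiv.sigmaFiberEquiv p with hf
  have hasm (M : ∀ l, Matrix {x // p x = l} {x // p x = l} ℂ)
      (hM : ∀ l, M l ∈ unitaryGroup {x // p x = l} ℂ) :
      (blockDiagonal' M).submatrix f.symm f.symm ∈ unitaryGroup X ℂ := by
    apply submatrix_mem_unitaryGroup
    rw [mem_unitaryGroup_iff, star_eq_conjTranspose, blockDiagonal'_conjTranspose,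
      ← blockDiagonal'_mul, ← blockDiagonal'_one]
    congr 1
    ext1 l
    exact mem_unitaryGroup_iff.mp (hM l)
  have happ (M : ∀ l, Matrix {x // p x = l} {x // p x = l} ℂ) (x y : X) (h : p x = p y) :
      (blockDiagonal' M).submatrix f.symm f.symm x y = M (p y) ⟨x, h⟩ ⟨y, rfl⟩ := by
    have hx : f.symm x = ⟨p y, x, h⟩ := by rw [Equiv.symm_apply_eq]; rfl
    have hy : f.symm y = ⟨p y, y, rfl⟩ := by rw [Equiv.symm_apply_eq]; rfl
    rw [submatrix_apply, hx, hy, blockDiagonal'_apply_eq]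
  have happ' (M : ∀ l, Matrix {x // p x = l} {x // p x = l} ℂ) (x y : X) (h : p x ≠ p y) :
      (blockDiagonal' M).submatrix f.symm f.symm x y = 0 :=
    blockDiagonal'_apply_ne M (k := p x) (k' := p y) ⟨x, rfl⟩ ⟨y, rfl⟩ h
  have hblock : U = (blockDiagonal' fun l => U.submatrix (Subtype.val : {x // p x = l} → X)
      Subtype.val).submatrix f.symm f.symm := by
    ext x y
    by_cases h : p x = p y
    · rw [happ _ _ _ h]
      rfl
    · rw [happ' _ _ _ h, hUp x y h]
  have hfib (l : L) : U.submatrix (Subtype.val : {x // p x = l} → X) Subtype.val ∈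
      unitaryGroup {x // p x = l} ℂ := by
    have h := submatrix_mem_unitaryGroup hU f
    rw [hblock, submatrix_submatrix] at h
    simp only [Equiv.symm_comp_self, submatrix_id_id] at h
    rw [mem_unitaryGroup_iff, star_eq_conjTranspose, blockDiagonal'_conjTranspose,
      ← blockDiagonal'_mul, ← blockDiagonal'_one] at h
    exact mem_unitaryGroup_iff.mpr (congrFun (blockDiagonal'_injective h) l)
  have hex (l : L) := exists_cosine_sine (fun x : {x // p x = l} => q x)
    (σ := fun x => ⟨σ x, (hσp x).trans x.2⟩) (fun x => Subtype.ext (hσ x))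
    (fun x hx => hσq x hx) (hfib l)
  choose A hA C hC B hB h hA' hC' hB' using hex
  refine ⟨_, hasm A hA, _, hasm C hC, _, hasm B hB, ?_, fun x y hxy => ?_,
    fun x y h1 h2 => ?_, fun x y hxy => ?_⟩
  · rw [submatrix_mul_equiv, submatrix_mul_equiv, ← blockDiagonal'_mul, ← blockDiagonal'_mul]
    conv_lhs => rw [hblock]
    simp only [h]
  · by_cases hp : p x = p y
    · rw [happ _ _ _ hp]
      exact hA' _ _ _ fun hq => hxy ⟨hp, hq⟩
    · exact happ' _ _ _ hp
  · by_cases hp : p x = p y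
    · rw [happ _ _ _ hp]
      exact hC' _ _ _ (fun h => h1 (congrArg Subtype.val h)) fun h => h2 (congrArg Subtype.val h)
    · exact happ' _ _ _ hp
  · by_cases hp : p x = p y
    · rw [happ _ _ _ hp]
      exact hB' _ _ _ fun hq => hxy ⟨hp, hq⟩
    · exact happ' _ _ _ hp

/-- The involution toggling the binary digit of weight `2 ^ m`, where this stays below `d`. -/
def flipDigit {d : ℕ} (m : ℕ) (a : Fin d) : Fin d :=
  if (a : ℕ).testBit m then ⟨a - 2 ^ m, (Nat.sub_le _ _).trans_lt a.2⟩
  else if h : (a : ℕ) + 2 ^ m < d then ⟨a + 2 ^ m, h⟩ else a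

theorem mod_two_pow_succ_eq_add_ite_testBit (a m : ℕ) :
    a % 2 ^ (m + 1) = a % 2 ^ m + (if a.testBit m then 2 ^ m else 0) := by
  rw [Nat.mod_pow_succ, ← Nat.toNat_testBit]
  cases a.testBit m <;> simp

theorem testBit_add_two_pow (a m : ℕ) : (a + 2 ^ m).testBit m = !a.testBit m := by
  rw [Nat.add_comm, Nat.testBit_two_pow_add_eq]

theorem testBit_sub_two_pow {a m : ℕ} (h : 2 ^ m ≤ a) :
    (a - 2 ^ m).testBit m = !a.testBit m := by
  conv_rhs => rw [← Nat.sub_add_cancel h, testBit_add_two_pow]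
  simp

theorem flipDigit_involutive {d : ℕ} (m : ℕ) :
    Function.Involutive (flipDigit m : Fin d → Fin d) := by
  intro a
  by_cases ha : (a : ℕ).testBit m
  · have hle := Nat.ge_two_pow_of_testBit ha
    have hb := testBit_sub_two_pow hle
    ext
    simp [flipDigit, ha, hb, Nat.sub_add_cancel hle]
  · by_cases h : (a : ℕ) + 2 ^ m < d
    · have hb := testBit_add_two_pow a m
      ext
      simp [flipDigit, ha, hb, h]
    · simp [flipDigit, ha, h]

theorem flipDigit_mod {d : ℕ} (m : ℕ) (a : Fin d) :
    (flipDigit m a : ℕ) % 2 ^ m = (a : ℕ) % 2 ^ m := by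
  unfold flipDigit
  split_ifs with ha h
  · have hle := Nat.ge_two_pow_of_testBit ha
    conv_rhs => rw [← Nat.sub_add_cancel hle]
    simp
  · simp
  · rfl

theorem not_testBit_flipDigit {d : ℕ} (m : ℕ) (a : Fin d) (ha : (a : ℕ).testBit m) :
    ¬ (flipDigit m a : ℕ).testBit m := by
  simp [flipDigit, ha, testBit_sub_two_pow (Nat.ge_two_pow_of_testBit ha)]

/-- Every unitary respecting the residues of the `j`-th index modulo `2 ^ e j` is a product of `m`
controlled unitaries. -/
def ResidueDecomposable {n : ℕ} (d : Fin n → ℕ) (e : Fin n → ℕ) (m : ℕ) : Prop :=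
  ∀ U ∈ unitaryGroup (∀ j, Fin (d j)) ℂ,
    (∀ x y : ∀ j, Fin (d j), (∃ j, (x j : ℕ) % 2 ^ e j ≠ (y j : ℕ) % 2 ^ e j) → U x y = 0) →
    ∃ l : List (Matrix (∀ j, Fin (d j)) (∀ j, Fin (d j)) ℂ), l.length = m ∧
      (∀ G ∈ l, G ∈ unitaryGroup (∀ j, Fin (d j)) ℂ ∧ ∃ t, CtrlTarget t G) ∧ U = l.prod

theorem ResidueDecomposable.of_update {n : ℕ} {d e : Fin n → ℕ} {m : ℕ} (j : Fin n)
    (h : ResidueDecomposable d (Function.update e j (e j + 1)) m) :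
    ResidueDecomposable d e (2 * m + 1) := by
  intro U hU hUe
  set p : (∀ i, Fin (d i)) → ∀ i, Fin (d i) := fun x i =>
    ⟨x i % 2 ^ e i, (Nat.mod_le _ _).trans_lt (x i).2⟩ with hp
  have hp_iff (x y) : p x = p y ↔ ∀ i, (x i : ℕ) % 2 ^ e i = (y i : ℕ) % 2 ^ e i := by
    simp [hp, funext_iff]
  set σ : (∀ i, Fin (d i)) → ∀ i, Fin (d i) := fun x =>
    Function.update x j (flipDigit (e j) (x j)) with hσdef
  have hσ : Function.Involutive σ := fun x => by simp [hσdef, flipDigit_involutive (e j) (x j)]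
  have hσp (x) : p (σ x) = p x := by
    rw [hp_iff]
    intro i
    rcases eq_or_ne i j with rfl | hi
    · simp [hσdef, flipDigit_mod]
    · simp [hσdef, hi]
  obtain ⟨A, hA, C, hC, B, hB, hUABC, hA', hC', hB'⟩ := exists_cosine_sine_of_blocks p
    (fun x => ¬ (x j : ℕ).testBit (e j)) hσ hσp
    (fun x hx => by
      simpa [hσdef] using not_testBit_flipDigit (e j) (x j) (not_not.mp hx))
    hU (fun x y hxy => hUe x y (by simpa [hp_iff] using hxy))
  have hrefine (x y : ∀ i, Fin (d i)) (hxy : ∃ i, (x i : ℕ) % 2 ^ Function.update e j (e j + 1) i ≠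
      (y i : ℕ) % 2 ^ Function.update e j (e j + 1) i) : ¬ (p x = p y ∧
        (¬ (x j : ℕ).testBit (e j) ↔ ¬ (y j : ℕ).testBit (e j))) := by
    rintro ⟨h1, h2⟩
    rw [hp_iff] at h1
    obtain ⟨i, hi⟩ := hxy
    rcases eq_or_ne i j with rfl | hij
    · rw [Function.update_self, mod_two_pow_succ_eq_add_ite_testBit,
        mod_two_pow_succ_eq_add_ite_testBit] at hi
      exact hi (by simp only [h1 i, not_iff_not.mp h2])
    · rw [Function.update_of_ne hij] at hi
      exact hi (h1 i)
  obtain ⟨lA, hlA, hlA', rfl⟩ := h A hA fun x y hxy => hA' x y (hrefine x y hxy)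
  obtain ⟨lB, hlB, hlB', rfl⟩ := h B hB fun x y hxy => hB' x y (hrefine x y hxy)
  refine ⟨lA ++ C :: lB, by simp [hlA, hlB]; ring, fun G hG => ?_, by
    simp [hUABC, Matrix.mul_assoc]⟩
  rw [List.mem_append, List.mem_cons] at hG
  rcases hG with hG | rfl | hG
  · exact hlA' G hG
  · refine ⟨hC, j, fun x y ⟨i, hij, hi⟩ => hC' x y (fun hxy => hi (hxy ▸ rfl)) fun hxy => hi ?_⟩
    rw [← hxy]
    simp [hσdef, hij]
  · exact hlB' G hG

theorem residueDecomposable_two_pow {n : ℕ} (d k : Fin n → ℕ) (hk : ∀ j, d j ≤ 2 ^ k j)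
    (t : Fin n) (s : Finset (Fin n)) (hs : ∀ j, j ≠ t → j ∈ s) (N : ℕ) (e : Fin n → ℕ)
    (hN : ∑ j ∈ s, (k j - e j) = N) : ResidueDecomposable d e (2 ^ (N + 1) - 1) := by
  induction N generalizing e with
  | zero =>
    intro U hU hUe
    refine ⟨[U], rfl, ?_, by simp⟩
    simp only [List.mem_singleton, forall_eq]
    refine ⟨hU, t, fun x y ⟨j, hj, hxy⟩ => hUe x y ⟨j, ?_⟩⟩
    have hle : k j ≤ e j := Nat.sub_eq_zero_iff_le.mp (Finset.sum_eq_zero_iff.mp hN j (hs j hj))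
    have hlt : d j ≤ 2 ^ e j := (hk j).trans (Nat.pow_le_pow_right two_pos hle)
    rw [Nat.mod_eq_of_lt ((x j).2.trans_le hlt), Nat.mod_eq_of_lt ((y j).2.trans_le hlt)]
    exact fun h => hxy (Fin.ext h)
  | succ N ih =>
    obtain ⟨j, hj, hje⟩ : ∃ j ∈ s, k j - e j ≠ 0 := by
      by_contra! h
      rw [Finset.sum_eq_zero h] at hN
      omega
    have hstep := ih (Function.update e j (e j + 1)) (by
      rw [← Finset.add_sum_erase _ _ hj] at hN ⊢
      have : ∑ i ∈ s.erase j, (k i - Function.update e j (e j + 1) i) =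
          ∑ i ∈ s.erase j, (k i - e i) :=
        Finset.sum_congr rfl fun i hi => by
          rw [Function.update_of_ne (Finset.ne_of_mem_erase hi)]
      rw [this, Function.update_self]
      omega)
    have := hstep.of_update j
    have hpos := Nat.one_le_two_pow (n := N + 1)
    rwa [show 2 * (2 ^ (N + 1) - 1) + 1 = 2 ^ (N + 1 + 1) - 1 by rw [pow_succ 2 (N + 1)]; omega]
      at this

theorem two_pow_clog_le {a : ℕ} (ha : 2 ≤ a) : 2 ^ Nat.clog 2 a ≤ 2 * a - 2 := by
  have h := Nat.pow_pred_clog_lt_self one_lt_two (by omega : 1 < a)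
  have hpos := Nat.clog_pos one_lt_two ha
  obtain ⟨c, hc⟩ := Nat.exists_eq_succ_of_ne_zero hpos.ne'
  rw [hc, Nat.pred_succ] at h
  rw [hc, Nat.succ_eq_add_one, pow_succ]
  omega

/-- Every `n`-partite unitary is the product of at most
`2 ∏_{j=1}^{n-1} (2 d_j − 2) − 1` unitaries, each controlled in the computational basis
from `n − 1` parties. -/
theorem multipartite_sandwich (n : ℕ) (hn : 1 ≤ n) (d : Fin n → ℕ) (hd : ∀ j, 2 ≤ d j)
    (U : Matrix (∀ j, Fin (d j)) (∀ j, Fin (d j)) ℂ)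
    (hU : U ∈ Matrix.unitaryGroup (∀ j, Fin (d j)) ℂ) :
    ∃ m : ℕ,
      m ≤ 2 * (∏ j : Fin (n - 1), (2 * d (Fin.castLE (Nat.sub_le n 1) j) - 2)) - 1 ∧
      ∃ f : Fin m → Matrix (∀ j, Fin (d j)) (∀ j, Fin (d j)) ℂ,
        (∀ i, f i ∈ Matrix.unitaryGroup (∀ j, Fin (d j)) ℂ) ∧
        (∀ i, ∃ t : Fin n, CtrlTarget t (f i)) ∧
        U = (List.ofFn f).prod := by
  set s : Finset (Fin n) := Finset.univ.map (Fin.castLEEmb (Nat.sub_le n 1)) with hs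
  have hmem (j : Fin n) (hj : j ≠ ⟨n - 1, by omega⟩) : j ∈ s := by
    have : (j : ℕ) ≠ n - 1 := fun h => hj (Fin.ext h)
    rw [hs, Finset.mem_map]
    exact ⟨⟨j, by omega⟩, Finset.mem_univ _, rfl⟩
  obtain ⟨l, hl, hl', rfl⟩ := residueDecomposable_two_pow d (fun j => Nat.clog 2 (d j))
    (fun j => Nat.le_pow_clog one_lt_two _) ⟨n - 1, by omega⟩ s hmem _ (fun _ => 0) rfl U hU
    (fun x y ⟨j, hj⟩ => by simp [Nat.mod_one] at hj)
  refine ⟨l.length, ?_, l.get, fun i => (hl' _ (l.get_mem i)).1, fun i => (hl' _ (l.get_mem i)).2,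
    by rw [List.ofFn_get]⟩
  rw [hl, pow_succ, mul_comm]
  refine Nat.sub_le_sub_right (Nat.mul_le_mul_left 2 ?_) 1
  rw [hs, Finset.sum_map, ← Finset.prod_pow_eq_pow_sum]
  exact Finset.prod_le_prod' fun j _ => two_pow_clog_le (hd _)
end

section
/- Let d_A, d_B, d_C, d_D ≥ 2. Every unitary on ℂ^{d_A} ⊗ ℂ^{d_B} ⊗ ℂ^{d_C} ⊗ ℂ^{d_D} (a unitary matrix indexed by Fin d_A × Fin d_B × Fin d_C × Fin d_D) is the product of at most 4·(d_A·d_B − 1)·(2·d_A + 2·d_C − 5) − 4·d_A + 5 unitaries, each of which is controlled in the computational basis with some single target party (i.e., each factor G satisfies, for some party t among A, B, C, D, that G_{x,y} = 0 whenever the coordinates of x and y differ on some party other than t). -/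
open Matrix BigOperators

section FourPartite

variable {dA dB dC dD : ℕ}

/-- Index type for a four-partite system. -/
abbrev Idx4 (dA dB dC dD : ℕ) := Fin dA × Fin dB × Fin dC × Fin dD

/-- Controlled in the computational basis with target party `A`:
entries vanish whenever the indices differ on `B`, `C` or `D`. -/
def CtrlTgtA (G : Matrix (Idx4 dA dB dC dD) (Idx4 dA dB dC dD) ℂ) : Prop :=
  ∀ x y : Idx4 dA dB dC dD, x.2 ≠ y.2 → G x y = 0

/-- Controlled in the computational basis with target party `B`. -/
def CtrlTgtB (G : Matrix (Idx4 dA dB dC dD) (Idx4 dA dB dC dD) ℂ) : Prop :=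
  ∀ x y : Idx4 dA dB dC dD, (x.1, x.2.2) ≠ (y.1, y.2.2) → G x y = 0

/-- Controlled in the computational basis with target party `C`. -/
def CtrlTgtC (G : Matrix (Idx4 dA dB dC dD) (Idx4 dA dB dC dD) ℂ) : Prop :=
  ∀ x y : Idx4 dA dB dC dD, (x.1, x.2.1, x.2.2.2) ≠ (y.1, y.2.1, y.2.2.2) → G x y = 0

/-- Controlled in the computational basis with target party `D`. -/
def CtrlTgtD (G : Matrix (Idx4 dA dB dC dD) (Idx4 dA dB dC dD) ℂ) : Prop :=
  ∀ x y : Idx4 dA dB dC dD, (x.1, x.2.1, x.2.2.1) ≠ (y.1, y.2.1, y.2.2.1) → G x y = 0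

section ControlledFactorization

variable {β : Type*} [Fintype β] [DecidableEq β]

/-- A square matrix with pairwise orthogonal columns is a unitary times a diagonal matrix. -/
lemma exists_unitary_mul_diagonal (P : Matrix β β ℂ) (d : β → ℂ)
    (h : Pᴴ * P = diagonal d) :
    ∃ U ∈ unitaryGroup β ℂ, ∃ c : β → ℂ, P = U * diagonal c := by
  classical
  let w : β → EuclideanSpace ℂ β := fun k => WithLp.toLp 2 (fun i => P i k)
  have hw : ∀ k l, k ≠ l → inner ℂ (w k) (w l) = 0 := by
    intro k l hkl
    have := congrFun (congrFun h k) l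
    rw [diagonal_apply_ne _ hkl] at this
    rw [← this]
    simp [w, PiLp.inner_apply, Matrix.mul_apply, mul_comm]
  let v : β → EuclideanSpace ℂ β := fun k => ((‖w k‖⁻¹ : ℝ) : ℂ) • w k
  have hv : Orthonormal ℂ (Set.domRestrict {k | w k ≠ 0} v) := by
    constructor
    · rintro ⟨k, hk⟩
      have : ‖w k‖ ≠ 0 := norm_ne_zero_iff.mpr hk
      simp [v, Set.domRestrict, norm_smul, this]
    · rintro ⟨k, hk⟩ ⟨l, hl⟩ hkl
      have : k ≠ l := fun e => hkl (Subtype.ext e)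
      simp [v, Set.domRestrict, inner_smul_left, inner_smul_right, hw k l this]
  obtain ⟨b, hb⟩ := hv.exists_orthonormalBasis_extension_of_card_eq (by simp)
  refine ⟨Matrix.of fun i k => b k i, ?_, fun k => (‖w k‖ : ℂ), ?_⟩
  · rw [mem_unitaryGroup_iff']
    ext k l
    have := orthonormal_iff_ite.mp b.orthonormal k l
    rw [one_apply, ← this]
    simp [PiLp.inner_apply, Matrix.mul_apply, star_eq_conjTranspose, mul_comm]
  · ext i k
    rw [mul_diagonal, of_apply]
    by_cases hk : w k = 0
    · have : w k i = 0 := by rw [hk]; rfl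
      simpa [hk, w] using this
    · rw [hb k hk]
      have : (‖w k‖ : ℂ) ≠ 0 := by simpa using hk
      simp only [v, PiLp.smul_apply, smul_eq_mul]
      push_cast
      rw [mul_comm, ← mul_assoc, mul_inv_cancel₀ this, one_mul]

/-- The kernel of the row `[X, -Y]` of two square matrices contains an isometry. -/
lemma exists_isometry_mul_eq_mul (X Y : Matrix β β ℂ) :
    ∃ P Q : Matrix β β ℂ, Pᴴ * P + Qᴴ * Q = 1 ∧ X * P = Y * Q := by
  classical
  let L : EuclideanSpace ℂ (β ⊕ β) →ₗ[ℂ] (β → ℂ) :=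
    (fromCols X (-Y)).mulVecLin ∘ₗ (WithLp.linearEquiv 2 ℂ (β ⊕ β → ℂ)).toLinearMap
  have hdim : Fintype.card β ≤ Module.finrank ℂ (LinearMap.ker L) := by
    have h1 := L.finrank_range_add_finrank_ker
    have h2 := (LinearMap.range L).finrank_le
    simp only [finrank_euclideanSpace, Fintype.card_sum, Module.finrank_fintype_fun_eq_card] at h1 h2
    omega
  let b := stdOrthonormalBasis ℂ (LinearMap.ker L)
  obtain ⟨f⟩ : Nonempty (β ↪ Fin (Module.finrank ℂ (LinearMap.ker L))) :=
    Function.Embedding.nonempty_of_card_le (by simpa using hdim)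
  refine ⟨Matrix.of fun i k => (b (f k) : EuclideanSpace ℂ (β ⊕ β)) (Sum.inl i),
    Matrix.of fun i k => (b (f k) : EuclideanSpace ℂ (β ⊕ β)) (Sum.inr i), ?_, ?_⟩
  · ext k l
    have := orthonormal_iff_ite.mp b.orthonormal (f k) (f l)
    rw [Submodule.coe_inner, PiLp.inner_apply, Fintype.sum_sum_type] at this
    simp only [f.injective.eq_iff] at this
    rw [one_apply, ← this]
    simp [Matrix.mul_apply, mul_comm]
  · ext i k
    have := congrFun (LinearMap.mem_ker.mp (b (f k)).2) i
    simp only [L, LinearMap.comp_apply, mulVecLin_apply, mulVec, dotProduct,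
      Fintype.sum_sum_type, fromCols_apply_inl, fromCols_apply_inr, Matrix.neg_apply, neg_mul,
      Finset.sum_neg_distrib, Pi.zero_apply] at this
    simpa [Matrix.mul_apply] using add_neg_eq_zero.mp this

/-- Two square matrices can be multiplied by unitaries so that corresponding rows become
parallel. -/
lemma exists_unitary_rows_parallel (X Y : Matrix β β ℂ) :
    ∃ V₁ ∈ unitaryGroup β ℂ, ∃ V₂ ∈ unitaryGroup β ℂ, ∃ c s : β → ℂ,
      (∀ k, c k * star (c k) + s k * star (s k) = 1) ∧
      ∀ k l, c k * (V₁ * X) k l = s k * (V₂ * Y) k l := by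
  obtain ⟨P, Q, hPQ, hXY⟩ := exists_isometry_mul_eq_mul Xᴴ Yᴴ
  have hH : (Pᴴ * P).IsHermitian := isHermitian_conjTranspose_mul_self P
  let W : Matrix β β ℂ := hH.eigenvectorUnitary
  let d : β → ℂ := fun k => (hH.eigenvalues k : ℂ)
  have hW : Wᴴ * W = 1 := mem_unitaryGroup_iff'.mp hH.eigenvectorUnitary.2
  have hW' : W * Wᴴ = 1 := mem_unitaryGroup_iff.mp hH.eigenvectorUnitary.2
  have hP : (P * W)ᴴ * (P * W) = diagonal d := by
    have hs : Pᴴ * P = W * diagonal d * Wᴴ := by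
      have := hH.spectral_theorem
      rwa [Unitary.conjStarAlgAut_apply] at this
    calc (P * W)ᴴ * (P * W) = Wᴴ * (Pᴴ * P) * W := by
          simp only [conjTranspose_mul, Matrix.mul_assoc]
      _ = (Wᴴ * W) * diagonal d * (Wᴴ * W) := by rw [hs]; simp only [Matrix.mul_assoc]
      _ = diagonal d := by rw [hW, Matrix.one_mul, Matrix.mul_one]
  have hsum : (P * W)ᴴ * (P * W) + (Q * W)ᴴ * (Q * W) = 1 := by
    calc _ = Wᴴ * (Pᴴ * P + Qᴴ * Q) * W := by
          simp only [conjTranspose_mul, Matrix.mul_assoc, Matrix.mul_add, Matrix.add_mul]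
      _ = 1 := by rw [hPQ, Matrix.mul_one, hW]
  have hQ : (Q * W)ᴴ * (Q * W) = diagonal (fun k => 1 - d k) := by
    rw [← diagonal_sub, diagonal_one, ← hP, ← hsum, add_sub_cancel_left]
  obtain ⟨U₁, hU₁, c, hc⟩ := exists_unitary_mul_diagonal _ _ hP
  obtain ⟨U₂, hU₂, s, hs⟩ := exists_unitary_mul_diagonal _ _ hQ
  have hcc : ∀ {U : Matrix β β ℂ} {c : β → ℂ}, U ∈ unitaryGroup β ℂ →
      (U * diagonal c)ᴴ * (U * diagonal c) = diagonal (fun k => star (c k) * c k) := by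
    intro U c hU
    have : Uᴴ * U = 1 := mem_unitaryGroup_iff'.mp hU
    rw [conjTranspose_mul, Matrix.mul_assoc, ← Matrix.mul_assoc Uᴴ, this, Matrix.one_mul,
      diagonal_conjTranspose, diagonal_mul_diagonal]
    rfl
  refine ⟨U₁ᴴ, Unitary.star_mem hU₁, U₂ᴴ, Unitary.star_mem hU₂, star c, star s, ?_, ?_⟩
  · intro k
    rw [hc, hs, hcc hU₁, hcc hU₂, diagonal_add] at hsum
    simpa using congrFun (congrFun hsum k) k
  · have h : Xᴴ * (U₁ * diagonal c) = Yᴴ * (U₂ * diagonal s) := by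
      rw [← hc, ← hs, ← Matrix.mul_assoc, ← Matrix.mul_assoc, hXY]
    have h' := congrArg conjTranspose h
    simp only [conjTranspose_mul, conjTranspose_conjTranspose, diagonal_conjTranspose,
      Matrix.mul_assoc] at h'
    intro k l
    simpa only [diagonal_mul] using congrFun (congrFun h' k) l

/-- A matrix acting on the coordinate pairs `{x, σ x}` is unitary if its `2 × 2` blocks are. -/
lemma pairwise_rotation_mem_unitaryGroup {κ : Type*} [Fintype κ] [DecidableEq κ] {σ : κ → κ}
    (hσ : Function.Involutive σ) {a g : κ → ℂ}
    (hnorm : ∀ x, a x * star (a x) + g x * star (g x) = 1)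
    (horth : ∀ x, a x * star (g (σ x)) + g x * star (a (σ x)) = 0) :
    (Matrix.of fun x y => (if y = x then a x else 0) + if y = σ x then g x else 0) ∈
      unitaryGroup κ ℂ := by
  rw [mem_unitaryGroup_iff]
  ext x y
  have key : ∀ F : κ → ℂ,
      ∑ z, ((if z = x then a x else 0) + if z = σ x then g x else 0) * F z =
        a x * F x + g x * F (σ x) := by
    intro F
    simp [add_mul, Finset.sum_add_distrib]
  simp only [Matrix.mul_apply, of_apply, star_apply, key, star_add]
  rw [one_apply]
  by_cases hxy : x = y
  · subst hxy
    by_cases hx : x = σ x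
    · have h1 := hnorm x
      have h2 := horth x
      rw [← hx] at h2
      simp only [← hx, if_true]
      linear_combination h1 + h2
    · simp only [if_true, if_neg hx, if_neg (Ne.symm hx), star_zero, add_zero, zero_add]
      exact hnorm x
  · have h1 : σ x ≠ σ y := fun h => hxy (hσ.injective h)
    by_cases hx : x = σ y
    · have h2 : σ x = y := by rw [hx, hσ]
      have := horth x
      rw [h2] at this
      simp only [if_neg hxy, if_pos hx, if_pos h2, if_neg h1, star_zero, add_zero, zero_add]
      exact this
    · have h2 : σ x ≠ y := fun h => hx (by rw [← h, hσ])
      simp [hxy, hx, h1, h2]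

/-- One parallel stage of block Givens rotations: blocks of rows are paired by the involution `σ`,
and in each pair the block of the row in `low` in the column `col` is annihilated. -/
lemma exists_parallel_block_rotation {α : Type*} [Fintype α] [DecidableEq α] (σ : α → α)
    (hσ : Function.Involutive σ) (low : α → Prop) (hlow : ∀ i, low i → ¬ low (σ i)) (col : α → α)
    (M : Matrix (β × α) (β × α) ℂ) (hM : M ∈ unitaryGroup (β × α) ℂ) :
    ∃ V ∈ unitaryGroup (β × α) ℂ, ∃ W ∈ unitaryGroup (β × α) ℂ,
      ∃ N ∈ unitaryGroup (β × α) ℂ, M = V * W * N ∧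
        (∀ x y, x.2 ≠ y.2 → V x y = 0) ∧ (∀ x y, x.1 ≠ y.1 → W x y = 0) ∧
        (∀ i, low i → ∀ k l, N (k, i) (l, col i) = 0) ∧
        ∀ i j, (∀ k l, M (k, i) (l, j) = 0) → (∀ k l, M (k, σ i) (l, j) = 0) →
          ∀ k l, N (k, i) (l, j) = 0 := by
  classical
  choose V₁ hV₁ V₂ hV₂ c s hcs hpar using fun i => exists_unitary_rows_parallel
    (Matrix.of fun k l => M (k, σ i) (l, col i)) (Matrix.of fun k l => M (k, i) (l, col i))
  let B : α → Matrix β β ℂ := fun i =>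
    if low i then V₂ i else if low (σ i) then V₁ (σ i) else 1
  have hB : ∀ i, B i ∈ unitaryGroup β ℂ := by
    intro i
    simp only [B]
    split_ifs
    exacts [hV₂ i, hV₁ _, one_mem _]
  let V : Matrix (β × α) (β × α) ℂ := blockDiagonal B
  have hV : V ∈ unitaryGroup (β × α) ℂ := by
    rw [mem_unitaryGroup_iff, star_eq_conjTranspose, blockDiagonal_conjTranspose,
      ← blockDiagonal_mul, ← blockDiagonal_one]
    congr 1
    funext i
    exact mem_unitaryGroup_iff.mp (hB i)
  let a : β × α → ℂ := fun x =>
    if low x.2 then - s x.2 x.1 else if low (σ x.2) then star (s (σ x.2) x.1) else 1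
  let g : β × α → ℂ := fun x =>
    if low x.2 then c x.2 x.1 else if low (σ x.2) then star (c (σ x.2) x.1) else 0
  let τ : β × α → β × α := fun x => (x.1, σ x.2)
  have hτ : Function.Involutive τ := fun x => by simp [τ, hσ x.2]
  let W : Matrix (β × α) (β × α) ℂ :=
    Matrix.of fun x y => (if y = x then a x else 0) + if y = τ x then g x else 0
  have hW : W ∈ unitaryGroup (β × α) ℂ := by
    refine pairwise_rotation_mem_unitaryGroup hτ ?_ ?_
    · rintro ⟨k, i⟩
      simp only [a, g]
      split_ifs with h1 h2
      · rw [star_neg]; linear_combination hcs i k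
      · rw [star_star, star_star]; linear_combination hcs (σ i) k
      · simp
    · rintro ⟨k, i⟩
      simp only [a, g, τ, hσ i]
      by_cases h1 : low i
      · simp only [h1, hlow i h1, if_true, if_false, star_star]
        ring
      · by_cases h2 : low (σ i)
        · simp only [h1, h2, if_true, if_false, star_neg]
          ring
        · simp [h1, h2]
  have hVM : ∀ k i l j, (V * M) (k, i) (l, j) =
      (B i * Matrix.of fun k l => M (k, i) (l, j)) k l := by
    intro k i l j
    simp only [V, Matrix.mul_apply, of_apply, blockDiagonal_apply, Fintype.sum_prod_type, ite_mul,
      zero_mul]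
    simp
  have hN : ∀ k i l j, (W * (V * M)) (k, i) (l, j) =
      a (k, i) * (V * M) (k, i) (l, j) + g (k, i) * (V * M) (k, σ i) (l, j) := by
    intro k i l j
    simp only [W, Matrix.mul_apply (M := Matrix.of _), of_apply, add_mul, Finset.sum_add_distrib,
      ite_mul, zero_mul, Finset.sum_ite_eq', Finset.mem_univ, if_true]
    simp [τ]
  refine ⟨star V, Unitary.star_mem hV, star W, Unitary.star_mem hW, W * (V * M),
    mul_mem hW (mul_mem hV hM), ?_, ?_, ?_, ?_, ?_⟩
  · rw [Matrix.mul_assoc, ← Matrix.mul_assoc (star W), mem_unitaryGroup_iff'.mp hW,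
      Matrix.one_mul, ← Matrix.mul_assoc, mem_unitaryGroup_iff'.mp hV, Matrix.one_mul]
  · intro x y hxy
    simp [V, star_apply, blockDiagonal_apply, hxy.symm]
  · intro x y hxy
    have h1 : x ≠ y := fun h => hxy (by rw [h])
    have h2 : x ≠ τ y := fun h => hxy (by rw [h])
    simp [W, star_apply, h1, h2]
  · intro i hi k l
    have := hpar i k l
    rw [hN, hVM, hVM]
    simp only [a, g, B, hi, hlow i hi, hσ i, if_true, if_false]
    linear_combination this
  · intro i j h1 h2 k l
    rw [hN, hVM, hVM]
    simp [Matrix.mul_apply, h1, h2]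

/-- The blocks strictly below the diagonal that are annihilated by the first `t` stages. -/
def StageZero {n : ℕ} (t : ℕ) (M : Matrix (β × Fin n) (β × Fin n) ℂ) : Prop :=
  ∀ i j : Fin n, j < i → 2 * (j : ℕ) + n ≤ t + i → ∀ k l, M (k, i) (l, j) = 0

/-- Passing from one stage of the annihilation ordering of Sameh and Kuck to the next. -/
lemma StageZero.exists_succ {n t : ℕ} {M : Matrix (β × Fin n) (β × Fin n) ℂ}
    (hM : M ∈ unitaryGroup (β × Fin n) ℂ) (hz : StageZero t M) :
    ∃ V ∈ unitaryGroup (β × Fin n) ℂ, ∃ W ∈ unitaryGroup (β × Fin n) ℂ,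
      ∃ N ∈ unitaryGroup (β × Fin n) ℂ, M = V * W * N ∧
        (∀ x y, x.2 ≠ y.2 → V x y = 0) ∧ (∀ x y, x.1 ≠ y.1 → W x y = 0) ∧
        StageZero (t + 1) N := by
  classical
  let low : ℕ → Prop := fun m => m < n ∧ ∃ j, j < m ∧ 2 * j + n = t + 1 + m
  have low_def : ∀ m, low m ↔ m < n ∧ ∃ j, j < m ∧ 2 * j + n = t + 1 + m := fun _ => Iff.rfl
  have low_adj : ∀ m, low m → ¬ low (m + 1) := by
    rintro m ⟨_, j, _, h⟩ ⟨_, j', _, h'⟩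
    omega
  have low_pos : ∀ m, low m → 0 < m := by
    rintro m ⟨_, j, h, _⟩
    omega
  let p : ℕ → ℕ := fun m => if low m then m - 1 else if low (m + 1) then m + 1 else m
  have p_low : ∀ m, low m → p m = m - 1 := fun m h => if_pos h
  have p_up : ∀ m, low (m + 1) → p m = m + 1 := fun m h => by
    have : ¬ low m := fun h' => low_adj m h' h
    simp [p, h, this]
  have p_id : ∀ m, ¬ low m → ¬ low (m + 1) → p m = m := fun m h h' => by simp [p, h, h']
  have p_lt : ∀ m, m < n → p m < n := by
    intro m hm
    by_cases h1 : low m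
    · rw [p_low m h1]; omega
    by_cases h2 : low (m + 1)
    · rw [p_up m h2]; exact h2.1
    · rwa [p_id m h1 h2]
  have p_inv : ∀ m, p (p m) = m := by
    intro m
    by_cases h1 : low m
    · have := low_pos m h1
      obtain ⟨q, rfl⟩ : ∃ q, m = q + 1 := ⟨m - 1, by omega⟩
      rw [p_low _ h1, Nat.add_sub_cancel, p_up q h1]
    by_cases h2 : low (m + 1)
    · rw [p_up m h2, p_low _ h2, Nat.add_sub_cancel]
    · rw [p_id m h1 h2, p_id m h1 h2]
  have p_not : ∀ m, low m → ¬ low (p m) := by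
    intro m h1 h2
    have := low_pos m h1
    rw [p_low m h1] at h2
    apply low_adj _ h2
    rwa [Nat.sub_add_cancel this]
  have hcol : ∀ i : Fin n, ∃ j : Fin n, ∀ j' : Fin n,
      2 * (j' : ℕ) + n = t + 1 + i → j = j' := by
    intro i
    by_cases h : ∃ j' : Fin n, 2 * (j' : ℕ) + n = t + 1 + i
    · obtain ⟨j, hj⟩ := h
      exact ⟨j, fun j' hj' => Fin.ext (by omega)⟩
    · exact ⟨i, fun j' hj' => (h ⟨j', hj'⟩).elim⟩
  choose col hcol using hcol
  obtain ⟨V, hV, W, hW, N, hN, hprod, hVt, hWt, hNlow, hNzero⟩ :=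
    exists_parallel_block_rotation (fun i : Fin n => (⟨p i, p_lt i i.2⟩ : Fin n))
      (fun i => Fin.ext (p_inv i)) (fun i => low i) (fun i => p_not i) col M hM
  refine ⟨V, hV, W, hW, N, hN, hprod, hVt, hWt, ?_⟩
  intro i j hji hst
  have hji' : (j : ℕ) < i := hji
  by_cases heq : 2 * (j : ℕ) + n = t + 1 + i
  · rw [← hcol i j heq]
    exact hNlow i ⟨i.2, j, hji', heq⟩
  refine hNzero i j (hz i j hji (by omega)) (hz _ j (Fin.lt_def.mpr ?_) ?_) <;>
  · by_cases h1 : low i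
    · obtain ⟨_, j₀, h, h'⟩ := (low_def i).mp h1
      simp only [p_low _ h1]
      omega
    by_cases h2 : low (i + 1)
    · simp only [p_up _ h2]
      omega
    · simp only [p_id _ h1 h2]
      omega

/-- After the last stage of the annihilation a unitary is block diagonal. -/
lemma StageZero.blockDiagonal {n : ℕ} {M : Matrix (β × Fin n) (β × Fin n) ℂ}
    (hM : M ∈ unitaryGroup (β × Fin n) ℂ) (hz : StageZero (2 * n - 3) M) :
    ∀ x y, x.2 ≠ y.2 → M x y = 0 := by
  have hT : M.BlockTriangular Prod.snd := by
    rintro ⟨k, i⟩ ⟨l, j⟩ (h : j < i)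
    have : (j : ℕ) < i := h
    exact hz i j h (by omega) k l
  have hinv : M⁻¹ = Mᴴ := inv_eq_left_inv (mem_unitaryGroup_iff'.mp hM)
  have : Invertible M := invertibleOfLeftInverse M Mᴴ (mem_unitaryGroup_iff'.mp hM)
  have hT' := blockTriangular_inv_of_blockTriangular hT
  rw [hinv] at hT'
  intro x y hxy
  rcases lt_or_gt_of_ne hxy with h | h
  · have := hT' (i := y) (j := x) h
    rwa [conjTranspose_apply, star_eq_zero] at this
  · exact hT h

/-- Simultaneous factorization of a family of bipartite unitaries into controlled unitaries:
any multiplicative cost `P` that is at most `p` on families controlled from `Fin n` and at most `q`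
on families controlled from `β` is at most `(2 n - 3) (p + q) + p`. -/
lemma family_controlled_factorization {γ : Type*} {n p q : ℕ}
    {P : ℕ → (γ → Matrix (β × Fin n) (β × Fin n) ℂ) → Prop}
    (hmul : ∀ m₁ m₂ U₁ U₂, P m₁ U₁ → P m₂ U₂ → P (m₁ + m₂) fun g => U₁ g * U₂ g)
    (hp : ∀ V, (∀ g, V g ∈ unitaryGroup (β × Fin n) ℂ) →
      (∀ g x y, x.2 ≠ y.2 → V g x y = 0) → P p V)
    (hq : ∀ W, (∀ g, W g ∈ unitaryGroup (β × Fin n) ℂ) →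
      (∀ g x y, x.1 ≠ y.1 → W g x y = 0) → P q W)
    (U : γ → Matrix (β × Fin n) (β × Fin n) ℂ) (hU : ∀ g, U g ∈ unitaryGroup (β × Fin n) ℂ) :
    P ((2 * n - 3) * (p + q) + p) U := by
  have main : ∀ r t, t + r = 2 * n - 3 → ∀ U : γ → Matrix (β × Fin n) (β × Fin n) ℂ,
      (∀ g, U g ∈ unitaryGroup (β × Fin n) ℂ) → (∀ g, StageZero t (U g)) →
      P (r * (p + q) + p) U := by
    intro r
    induction r with
    | zero =>
      intro t ht U hU hz
      obtain rfl : t = 2 * n - 3 := by omega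
      rw [Nat.zero_mul, Nat.zero_add]
      exact hp U hU fun g => (hz g).blockDiagonal (hU g)
    | succ r ih =>
      intro t ht U hU hz
      choose V hV W hW N hN hprod hVt hWt hNz using fun g => (hz g).exists_succ (hU g)
      have := hmul _ _ _ _ (hmul _ _ _ _ (hp V hV hVt) (hq W hW hWt))
        (ih (t + 1) (by omega) N hN hNz)
      rw [show (r + 1) * (p + q) + p = p + q + (r * (p + q) + p) by ring]
      convert this using 2 with g
      exact hprod g
  refine main _ 0 (by omega) U hU fun g i j hji hst => ?_
  have := i.2
  omega

/-- Factorization of a unitary on `β × Fin n × γ`, controlled from `γ`, into unitaries that are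
controlled from `γ` and one of `Fin n` and `β`. -/
lemma controlled_factorization {ι γ : Type*} [Fintype ι] [DecidableEq ι] [Fintype γ]
    [DecidableEq γ] {n p q : ℕ} (e : ι ≃ (β × Fin n) × γ)
    {P : ℕ → Matrix ι ι ℂ → Prop}
    (hmul : ∀ m₁ m₂ U₁ U₂, P m₁ U₁ → P m₂ U₂ → P (m₁ + m₂) (U₁ * U₂))
    (hp : ∀ V ∈ unitaryGroup ι ℂ,
      (∀ x y, ((e x).1.2, (e x).2) ≠ ((e y).1.2, (e y).2) → V x y = 0) → P p V)
    (hq : ∀ W ∈ unitaryGroup ι ℂ,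
      (∀ x y, ((e x).1.1, (e x).2) ≠ ((e y).1.1, (e y).2) → W x y = 0) → P q W)
    (U : Matrix ι ι ℂ) (hU : U ∈ unitaryGroup ι ℂ)
    (hctrl : ∀ x y, (e x).2 ≠ (e y).2 → U x y = 0) :
    P ((2 * n - 3) * (p + q) + p) U := by
  let Φ : (γ → Matrix (β × Fin n) (β × Fin n) ℂ) → Matrix ι ι ℂ := fun F =>
    (blockDiagonal F).submatrix e e
  have Φ_apply : ∀ F x y, Φ F x y = if (e x).2 = (e y).2 then F (e x).2 (e x).1 (e y).1 else 0 :=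
    fun F x y => rfl
  have Φ_mul : ∀ F G, Φ (fun g => F g * G g) = Φ F * Φ G := by
    intro F G
    simp only [Φ, blockDiagonal_mul, submatrix_mul_equiv]
  have Φ_star : ∀ F, star (Φ F) = Φ (fun g => star (F g)) := by
    intro F
    simp only [Φ, star_eq_conjTranspose, conjTranspose_submatrix, blockDiagonal_conjTranspose]
  have Φ_one : Φ (fun _ => 1) = 1 := by
    have : blockDiagonal (fun _ : γ => (1 : Matrix (β × Fin n) (β × Fin n) ℂ)) = 1 :=
      blockDiagonal_one
    simp only [Φ, this, submatrix_one_equiv]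
  have Φ_unitary : ∀ F, (∀ g, F g ∈ unitaryGroup (β × Fin n) ℂ) → Φ F ∈ unitaryGroup ι ℂ := by
    intro F hF
    rw [mem_unitaryGroup_iff, Φ_star, ← Φ_mul, ← Φ_one]
    congr 1
    funext g
    exact mem_unitaryGroup_iff.mp (hF g)
  let F : γ → Matrix (β × Fin n) (β × Fin n) ℂ := fun g =>
    Matrix.of fun x y => U (e.symm (x, g)) (e.symm (y, g))
  have hF : Φ F = U := by
    ext x y
    rw [Φ_apply]
    split_ifs with h
    · simp only [F, of_apply, Prod.mk.eta, Equiv.symm_apply_apply]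
      rw [h, Prod.mk.eta, Equiv.symm_apply_apply]
    · exact (hctrl x y h).symm
  have hFU : ∀ g, F g ∈ unitaryGroup (β × Fin n) ℂ := by
    intro g
    rw [mem_unitaryGroup_iff]
    have h := mem_unitaryGroup_iff.mp hU
    rw [← hF, Φ_star, ← Φ_mul, ← Φ_one] at h
    ext x y
    have := congrFun (congrFun h (e.symm (x, g))) (e.symm (y, g))
    rwa [Φ_apply, Φ_apply, e.apply_symm_apply, e.apply_symm_apply, if_pos rfl, if_pos rfl] at this
  rw [← hF]
  refine family_controlled_factorization (P := fun m F => P m (Φ F)) ?_ ?_ ?_ F hFU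
  · intro m₁ m₂ U₁ U₂ h₁ h₂
    rw [Φ_mul]
    exact hmul _ _ _ _ h₁ h₂
  · intro V hV hVt
    refine hp _ (Φ_unitary V hV) fun x y hxy => ?_
    rw [Φ_apply]
    split_ifs with h
    · exact hVt _ _ _ fun h' => hxy (Prod.ext h' h)
    · rfl
  · intro W hW hWt
    refine hq _ (Φ_unitary W hW) fun x y hxy => ?_
    rw [Φ_apply]
    split_ifs with h
    · exact hWt _ _ _ fun h' => hxy (Prod.ext h' h)
    · rfl

end ControlledFactorization

/-- `U` is a product of at most `m` unitaries, each controlled from three parties. -/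
def IsControlledProduct (m : ℕ) (U : Matrix (Idx4 dA dB dC dD) (Idx4 dA dB dC dD) ℂ) : Prop :=
  ∃ l : List (Matrix (Idx4 dA dB dC dD) (Idx4 dA dB dC dD) ℂ), l.length ≤ m ∧
    (∀ G ∈ l, G ∈ Matrix.unitaryGroup (Idx4 dA dB dC dD) ℂ) ∧
    (∀ G ∈ l, CtrlTgtA G ∨ CtrlTgtB G ∨ CtrlTgtC G ∨ CtrlTgtD G) ∧ U = l.prod

lemma IsControlledProduct.mul (m₁ m₂ : ℕ)
    (U₁ U₂ : Matrix (Idx4 dA dB dC dD) (Idx4 dA dB dC dD) ℂ) (h₁ : IsControlledProduct m₁ U₁)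
    (h₂ : IsControlledProduct m₂ U₂) : IsControlledProduct (m₁ + m₂) (U₁ * U₂) := by
  obtain ⟨l₁, hm₁, hu₁, hc₁, rfl⟩ := h₁
  obtain ⟨l₂, hm₂, hu₂, hc₂, rfl⟩ := h₂
  refine ⟨l₁ ++ l₂, by simpa using Nat.add_le_add hm₁ hm₂, ?_, ?_, by simp⟩ <;>
  · intro G hG
    rcases List.mem_append.mp hG with h | h
    · solve_by_elim
    · solve_by_elim

lemma IsControlledProduct.of_controlled {U : Matrix (Idx4 dA dB dC dD) (Idx4 dA dB dC dD) ℂ}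
    (hU : U ∈ Matrix.unitaryGroup (Idx4 dA dB dC dD) ℂ)
    (h : CtrlTgtA U ∨ CtrlTgtB U ∨ CtrlTgtC U ∨ CtrlTgtD U) : IsControlledProduct 1 U :=
  ⟨[U], by simp, by simpa using hU, by simpa using h, by simp⟩

/-- A unitary controlled from `A` and `B` factors into `4 dC - 5` controlled unitaries. -/
lemma IsControlledProduct.of_controlled_AB
    {U : Matrix (Idx4 dA dB dC dD) (Idx4 dA dB dC dD) ℂ}
    (hU : U ∈ Matrix.unitaryGroup (Idx4 dA dB dC dD) ℂ)
    (h : ∀ x y, (x.1, x.2.1) ≠ (y.1, y.2.1) → U x y = 0) :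
    IsControlledProduct ((2 * dC - 3) * (1 + 1) + 1) U := by
  let e : Idx4 dA dB dC dD ≃ (Fin dD × Fin dC) × (Fin dA × Fin dB) :=
    { toFun := fun x => ((x.2.2.2, x.2.2.1), (x.1, x.2.1))
      invFun := fun z => (z.2.1, z.2.2, z.1.2, z.1.1)
      left_inv := fun _ => rfl
      right_inv := fun _ => rfl }
  refine controlled_factorization e IsControlledProduct.mul ?_ ?_ U hU h
  · intro V hV hVt
    refine .of_controlled hV (Or.inr (Or.inr (Or.inr fun x y hxy => hVt x y fun h' => hxy ?_)))
    simp only [e, Equiv.coe_fn_mk, Prod.mk.injEq] at h' ⊢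
    tauto
  · intro V hV hVt
    refine .of_controlled hV (Or.inr (Or.inr (Or.inl fun x y hxy => hVt x y fun h' => hxy ?_)))
    simp only [e, Equiv.coe_fn_mk, Prod.mk.injEq] at h' ⊢
    tauto

/-- A unitary controlled from `C` and `D` factors into `4 dA - 5` controlled unitaries. -/
lemma IsControlledProduct.of_controlled_CD
    {U : Matrix (Idx4 dA dB dC dD) (Idx4 dA dB dC dD) ℂ}
    (hU : U ∈ Matrix.unitaryGroup (Idx4 dA dB dC dD) ℂ)
    (h : ∀ x y, x.2.2 ≠ y.2.2 → U x y = 0) :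
    IsControlledProduct ((2 * dA - 3) * (1 + 1) + 1) U := by
  let e : Idx4 dA dB dC dD ≃ (Fin dB × Fin dA) × (Fin dC × Fin dD) :=
    { toFun := fun x => ((x.2.1, x.1), x.2.2)
      invFun := fun z => (z.1.2, z.1.1, z.2)
      left_inv := fun _ => rfl
      right_inv := fun _ => rfl }
  refine controlled_factorization e IsControlledProduct.mul ?_ ?_ U hU h
  · intro V hV hVt
    refine .of_controlled hV (Or.inr (Or.inl fun x y hxy => hVt x y fun h' => hxy ?_))
    simpa only [e, Equiv.coe_fn_mk] using h'
  · intro V hV hVt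
    refine .of_controlled hV (Or.inl fun x y hxy => hVt x y fun h' => hxy ?_)
    simp only [e, Equiv.coe_fn_mk, Prod.mk.injEq] at h'
    exact Prod.ext h'.1 h'.2

/-- Every four-partite unitary is the product of at most
`4 (d_A d_B − 1)(2 d_A + 2 d_C − 5) − 4 d_A + 5` unitaries, each controlled in the
computational basis from three parties. -/
theorem fourpartite_sandwich (hdA : 2 ≤ dA) (hdB : 2 ≤ dB) (hdC : 2 ≤ dC) (hdD : 2 ≤ dD)
    (U : Matrix (Idx4 dA dB dC dD) (Idx4 dA dB dC dD) ℂ)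
    (hU : U ∈ Matrix.unitaryGroup (Idx4 dA dB dC dD) ℂ) :
    ∃ m : ℕ,
      m ≤ 4 * (dA * dB - 1) * (2 * dA + 2 * dC - 5) - 4 * dA + 5 ∧
      ∃ f : Fin m → Matrix (Idx4 dA dB dC dD) (Idx4 dA dB dC dD) ℂ,
        (∀ i, f i ∈ Matrix.unitaryGroup (Idx4 dA dB dC dD) ℂ) ∧
        (∀ i, CtrlTgtA (f i) ∨ CtrlTgtB (f i) ∨ CtrlTgtC (f i) ∨ CtrlTgtD (f i)) ∧
        U = (List.ofFn f).prod := by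
  let e : Idx4 dA dB dC dD ≃ ((Fin dC × Fin dD) × Fin (dA * dB)) × Unit :=
    { toFun := fun x => ((x.2.2, finProdFinEquiv (x.1, x.2.1)), ())
      invFun := fun z =>
        ((finProdFinEquiv.symm z.1.2).1, (finProdFinEquiv.symm z.1.2).2, z.1.1)
      left_inv := fun x => by simp only [Equiv.symm_apply_apply]
      right_inv := fun z => by
        obtain ⟨⟨u, v⟩, w⟩ := z
        simp only [Prod.mk.eta, Equiv.apply_symm_apply] }
  have key : IsControlledProduct _ U :=
    controlled_factorization e IsControlledProduct.mul
      (fun V hV hVt => IsControlledProduct.of_controlled_AB hV fun x y hxy =>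
        hVt x y fun h => hxy (finProdFinEquiv.injective (congrArg Prod.fst h)))
      (fun W hW hWt => IsControlledProduct.of_controlled_CD hW fun x y hxy =>
        hWt x y fun h => hxy (congrArg Prod.fst h))
      U hU (fun _ _ h => (h rfl).elim)
  obtain ⟨l, hl, hlu, hlc, hprod⟩ := key
  refine ⟨l.length, hl.trans ?_, l.get, fun i => hlu _ (l.get_mem i), fun i => hlc _ (l.get_mem i),
    by rw [List.ofFn_get, hprod]⟩
  have hN : 2 ≤ dA * dB := by nlinarith
  obtain ⟨k, hk⟩ := Nat.exists_eq_add_of_le' hN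
  obtain ⟨a, rfl⟩ := Nat.exists_eq_add_of_le' hdA
  obtain ⟨c, rfl⟩ := Nat.exists_eq_add_of_le' hdC
  rw [hk, show 2 * (k + 2) - 3 = 2 * k + 1 by omega, show 2 * (a + 2) - 3 = 2 * a + 1 by omega,
    show 2 * (c + 2) - 3 = 2 * c + 1 by omega, show k + 2 - 1 = k + 1 by omega,
    show 2 * (a + 2) + 2 * (c + 2) - 5 = 2 * a + 2 * c + 3 by omega]
  have : 4 * (k + 1) * (2 * a + 2 * c + 3) =
      ((2 * k + 1) * ((2 * c + 1) * (1 + 1) + 1 + ((2 * a + 1) * (1 + 1) + 1)) +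
        ((2 * c + 1) * (1 + 1) + 1)) + 4 * a + 3 := by ring
  omega


end FourPartite
end

section
/- Let d_A, d_B ≥ 2 and set m = 2·(d_A − 1)²·⌊d_B/2⌋ + (2·d_A − 3)·(d_B − 1)·⌊d_A/2⌋. Every unitary U on the d_A × d_B system can be written as U = L_0 G_1 L_1 G_2 ⋯ G_m L_m, where each L_i is a local unitary (of the form X ⊗ Y) and each G_i is a standard gate in computational position. -/
open Matrix Kronecker BigOperators

/-- A local unitary on the bipartite system: a Kronecker product of local unitaries. -/
def IsLocalUnitary {dA dB : ℕ} (L : Matrix (Fin dA × Fin dB) (Fin dA × Fin dB) ℂ) : Prop :=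
  ∃ (X : Matrix (Fin dA) (Fin dA) ℂ) (Y : Matrix (Fin dB) (Fin dB) ℂ),
    X ∈ Matrix.unitaryGroup (Fin dA) ℂ ∧ Y ∈ Matrix.unitaryGroup (Fin dB) ℂ ∧ L = X ⊗ₖ Y

/-- A standard gate in computational position: a unitary which fixes all computational
basis vectors outside a `2 × 2` sub-grid `{a₀,a₁} × {b₀,b₁}`, and whose restriction to
that sub-grid, as a matrix indexed by `Fin 2 × Fin 2`, has Schmidt rank at most 2. -/
def IsStdGate {dA dB : ℕ} (G : Matrix (Fin dA × Fin dB) (Fin dA × Fin dB) ℂ) : Prop :=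
  G ∈ Matrix.unitaryGroup (Fin dA × Fin dB) ℂ ∧
  ∃ (a : Fin 2 → Fin dA) (b : Fin 2 → Fin dB),
    Function.Injective a ∧ Function.Injective b ∧
    (∀ q : Fin dA × Fin dB, ((∀ i, q.1 ≠ a i) ∨ (∀ j, q.2 ≠ b j)) →
      ∀ p : Fin dA × Fin dB, G p q = if p = q then 1 else 0) ∧
    ∃ A₁ B₁ A₂ B₂ : Matrix (Fin 2) (Fin 2) ℂ,
      ∀ p q : Fin 2 × Fin 2,
        G (a p.1, b p.2) (a q.1, b q.2) = (A₁ ⊗ₖ B₁ + A₂ ⊗ₖ B₂) p q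


theorem OrthonormalBasis.of_apply_mem_unitaryGroup {ι : Type*} [Fintype ι] [DecidableEq ι]
    (e : OrthonormalBasis ι ℂ (EuclideanSpace ℂ ι)) :
    (Matrix.of fun a b => e b a) ∈ Matrix.unitaryGroup ι ℂ := by
  rw [Matrix.mem_unitaryGroup_iff']
  ext i j
  have h := orthonormal_iff_ite.1 e.orthonormal i j
  rw [PiLp.inner_apply] at h
  simp only [RCLike.inner_apply] at h
  simp only [Matrix.mul_apply, Matrix.star_apply, Matrix.of_apply, Matrix.one_apply]
  rw [← h]
  exact Finset.sum_congr rfl fun x _ => mul_comm _ _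

theorem Matrix.exists_unitary_mul_diagonal {β : Type*} [Fintype β] [DecidableEq β]
    (X : Matrix β β ℂ) (g : β → ℂ) (hX : Xᴴ * X = Matrix.diagonal g) :
    ∃ V ∈ Matrix.unitaryGroup β ℂ, ∃ c : β → ℝ, X = V * Matrix.diagonal (fun b => (c b : ℂ)) := by
  let x : β → EuclideanSpace ℂ β := fun b => WithLp.toLp 2 fun a => X a b
  have hx : ∀ b b', inner ℂ (x b) (x b') = (Matrix.diagonal g) b b' := by
    intro b b'
    rw [← hX, PiLp.inner_apply]
    simp only [RCLike.inner_apply, Matrix.mul_apply, Matrix.conjTranspose_apply, x]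
    exact Finset.sum_congr rfl fun x _ => mul_comm _ _
  let v : β → EuclideanSpace ℂ β := fun b => ((‖x b‖⁻¹ : ℝ) : ℂ) • x b
  have hv : Orthonormal ℂ ({b | x b ≠ 0}.domRestrict v) := by
    constructor
    · rintro ⟨b, hb⟩
      have : ‖x b‖ ≠ 0 := norm_ne_zero_iff.2 hb
      simp [v, norm_smul, this]
    · rintro ⟨b, hb⟩ ⟨b', hb'⟩ hne
      have hne' : b ≠ b' := fun h => hne (Subtype.ext h)
      simp [v, inner_smul_left, inner_smul_right, hx, Matrix.diagonal_apply_ne _ hne']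
  obtain ⟨e, he⟩ := hv.exists_orthonormalBasis_extension_of_card_eq (by simp)
  refine ⟨_, e.of_apply_mem_unitaryGroup, fun b => ‖x b‖, ?_⟩
  ext a b
  rw [Matrix.mul_diagonal, Matrix.of_apply]
  by_cases hb : x b = 0
  · have : X a b = (x b) a := rfl
    simp [this, hb]
  · have h0 : (‖x b‖ : ℂ) ≠ 0 := by exact_mod_cast norm_ne_zero_iff.2 hb
    rw [he b hb]
    change X a b = ((‖x b‖⁻¹ : ℝ) : ℂ) * X a b * ‖x b‖
    push_cast
    field_simp

theorem Matrix.exists_unitary_mul_apply_zero {β : Type*} [Fintype β] [DecidableEq β]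
    (X : Matrix (Fin 2 × β) β ℂ) :
    ∃ Q ∈ Matrix.unitaryGroup (Fin 2 × β) ℂ, ∀ b b', (Q * X) (0, b) b' = 0 := by
  let x : β → EuclideanSpace ℂ (Fin 2 × β) := fun b => WithLp.toLp 2 fun a => X a b
  let S : Submodule ℂ (EuclideanSpace ℂ (Fin 2 × β)) := Submodule.span ℂ (Set.range x)
  have hS : Module.finrank ℂ S ≤ Fintype.card β := finrank_range_le_card x
  have hK : Fintype.card β ≤ Module.finrank ℂ Sᗮ := by
    have := S.finrank_add_finrank_orthogonal
    rw [finrank_euclideanSpace, Fintype.card_prod, Fintype.card_fin] at this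
    omega
  let u := stdOrthonormalBasis ℂ Sᗮ
  obtain ⟨f⟩ : Nonempty (β ↪ Fin (Module.finrank ℂ Sᗮ)) :=
    Function.Embedding.nonempty_of_card_le (by simpa using hK)
  let v : Fin 2 × β → EuclideanSpace ℂ (Fin 2 × β) := fun p => (u (f p.2) : _)
  have hv : Orthonormal ℂ ({p : Fin 2 × β | p.1 = 0}.domRestrict v) := by
    have h := (u.orthonormal.comp_linearIsometry Sᗮ.subtypeₗᵢ)
    refine h.comp (fun p : {p : Fin 2 × β | p.1 = 0} => f p.1.2) ?_
    rintro ⟨⟨i, b⟩, hi⟩ ⟨⟨j, b'⟩, hj⟩ h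
    have := f.injective h
    simp only [Set.mem_ofPred_eq] at hi hj
    simp_all
  obtain ⟨e, he⟩ := hv.exists_orthonormalBasis_extension_of_card_eq (by simp)
  refine ⟨_, Unitary.star_mem e.of_apply_mem_unitaryGroup, fun b b' => ?_⟩
  have h0 : inner ℂ (e (0, b)) (x b') = 0 := by
    rw [he (0, b) rfl]
    exact S.inner_left_of_mem_orthogonal (Submodule.subset_span ⟨b', rfl⟩) (u (f b)).2
  rw [← h0, PiLp.inner_apply, Matrix.mul_apply]
  simp only [RCLike.inner_apply, Matrix.star_apply, Matrix.of_apply, x]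
  exact Finset.sum_congr rfl fun x _ => mul_comm _ _

theorem Matrix.exists_unit_det_sub_ne_zero {β : Type*} [Fintype β] [DecidableEq β]
    (V : Matrix β β ℂ) : ∃ z : ℂ, star z * z = 1 ∧ (Matrix.scalar β z - V).det ≠ 0 := by
  have hinf : (Metric.sphere (0 : ℂ) 1).Infinite := by
    refine Set.infinite_of_injOn_mapsTo (s := Set.Ioc (0 : ℝ) 1) (f := fun x => (Circle.exp x : ℂ))
      ?_ (fun x _ => by simp) (Set.Ioc_infinite one_pos)
    have harg : ∀ x ∈ Set.Ioc (0 : ℝ) 1, Complex.arg (Circle.exp x) = x := fun x hx =>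
      Circle.arg_exp (by linarith [hx.1, Real.pi_pos]) (by linarith [hx.2, Real.pi_gt_three])
    intro x hx y hy hxy
    rw [← harg x hx, ← harg y hy]
    exact congrArg Complex.arg hxy
  obtain ⟨z, hz, hz'⟩ := hinf.exists_notMem_finset V.charpoly.roots.toFinset
  refine ⟨z, ?_, ?_⟩
  · have : ‖z‖ = 1 := by simpa using hz
    rw [Complex.star_def, ← Complex.normSq_eq_conj_mul_self, Complex.normSq_eq_norm_sq, this]
    simp
  · rw [← Matrix.eval_charpoly]
    intro h
    exact hz' (by simpa [V.charpoly_monic.ne_zero] using h)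

theorem Matrix.exists_unitary_diagonal {β : Type*} [Fintype β] [DecidableEq β]
    (V : Matrix β β ℂ) (hV : V ∈ Matrix.unitaryGroup β ℂ) :
    ∃ W ∈ Matrix.unitaryGroup β ℂ, ∃ c : β → ℂ, (∀ b, star (c b) * c b = 1) ∧
      V = W * Matrix.diagonal c * Wᴴ := by
  obtain ⟨z, hz, hdet⟩ := V.exists_unit_det_sub_ne_zero
  rw [Matrix.mem_unitaryGroup_iff', Matrix.star_eq_conjTranspose] at hV
  set N := Matrix.scalar β z - V with hN
  have hNu : IsUnit N.det := isUnit_iff_ne_zero.2 hdet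
  have hN' : N = z • 1 - V := by simp [hN, Matrix.smul_one_eq_diagonal]
  let H : Matrix β β ℂ := (Complex.I • (z • 1 + V)) * N⁻¹
  have hHN : H * N = Complex.I • (z • 1 + V) := Matrix.nonsing_inv_mul_cancel_right _ _ hNu
  have hH : H.IsHermitian := by
    have h1 : Nᴴ * Hᴴ * N = Nᴴ * H * N := by
      rw [← Matrix.conjTranspose_mul, hHN, Matrix.mul_assoc, hHN, hN']
      simp only [Matrix.conjTranspose_smul, Matrix.conjTranspose_add, Matrix.conjTranspose_sub,
        Matrix.conjTranspose_one, Matrix.smul_mul, Matrix.mul_smul, Matrix.sub_mul, Matrix.add_mul,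
        Matrix.mul_add, Matrix.mul_sub, Matrix.one_mul, Matrix.mul_one, hV, smul_smul]
      rw [show star Complex.I = -Complex.I from Complex.conj_I]
      match_scalars
      · linear_combination (-2 * Complex.I) * hz
      all_goals ring
    have h2 := congrArg (fun M => (Nᴴ)⁻¹ * M * N⁻¹) h1
    have hNu' : IsUnit (Nᴴ).det := by rw [Matrix.det_conjTranspose]; exact hNu.star
    change Hᴴ = H
    simpa [Matrix.mul_assoc, Matrix.mul_nonsing_inv _ hNu,
      Matrix.nonsing_inv_mul_cancel_left _ _ hNu'] using h2
  let W : Matrix β β ℂ := hH.eigenvectorUnitary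
  have hW : W ∈ Matrix.unitaryGroup β ℂ := hH.eigenvectorUnitary.2
  have hWW : W * Wᴴ = 1 := Matrix.mem_unitaryGroup_iff.1 hW
  have hWW' : Wᴴ * W = 1 := Matrix.mem_unitaryGroup_iff'.1 hW
  have hs : H = W * Matrix.diagonal (fun b => (hH.eigenvalues b : ℂ)) * Wᴴ := hH.spectral_theorem
  set D := Matrix.diagonal (fun b => (hH.eigenvalues b : ℂ)) with hD
  have h3 : Wᴴ * (H * N) * W = D * (z • 1 - Wᴴ * V * W) := by
    rw [hs, hN', Matrix.mul_sub, Matrix.mul_sub, Matrix.mul_sub, Matrix.sub_mul]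
    simp only [Matrix.mul_smul, Matrix.mul_one, Matrix.smul_mul, Matrix.mul_assoc, hWW']
    simp only [← Matrix.mul_assoc, hWW', Matrix.one_mul]
  have h4 : Complex.I • (z • 1 + Wᴴ * V * W) = D * (z • 1 - Wᴴ * V * W) := by
    rw [← h3, hHN]
    simp only [Matrix.mul_smul, Matrix.mul_one, Matrix.smul_mul, Matrix.mul_add, Matrix.add_mul,
      hWW']
  set T := Wᴴ * V * W with hT
  have hoff : ∀ a b, a ≠ b → T a b = 0 := by
    intro a b hab
    have h5 := congrFun (congrFun h4 a) b
    simp only [hD, Matrix.diagonal_mul, Matrix.smul_apply, Matrix.add_apply, Matrix.sub_apply,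
      Matrix.one_apply_ne hab, smul_eq_mul] at h5
    have h6 : (Complex.I + (hH.eigenvalues a : ℂ)) * T a b = 0 := by linear_combination h5
    refine (mul_eq_zero.1 h6).resolve_left fun h => ?_
    simpa using congrArg Complex.im h
  have hTd : T = Matrix.diagonal fun b => T b b := by
    ext a b
    by_cases hab : a = b
    · subst hab; simp
    · rw [hoff a b hab, Matrix.diagonal_apply_ne _ hab]
  have hTu : Tᴴ * T = 1 := by
    rw [hT]
    simp only [Matrix.conjTranspose_mul, Matrix.conjTranspose_conjTranspose, Matrix.mul_assoc]
    rw [← Matrix.mul_assoc W, hWW, Matrix.one_mul, ← Matrix.mul_assoc Vᴴ, hV, Matrix.one_mul, hWW']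
  refine ⟨W, hW, fun b => T b b, fun b => ?_, ?_⟩
  · have := congrFun (congrFun hTu b) b
    rw [hTd] at this
    simpa using this
  · rw [← hTd, hT]
    simp only [Matrix.mul_assoc, hWW, Matrix.mul_one]
    rw [← Matrix.mul_assoc, hWW, Matrix.one_mul]

set_option linter.unusedSectionVars false

section Embedding

variable {μ ν : Type*} [Fintype μ] [DecidableEq μ] [Fintype ν] [DecidableEq ν]

/-- Extension of a matrix along an injection of index types, by the identity outside the range. -/
def Matrix.extendOne (g : μ → ν) (Q : Matrix μ μ ℂ) : Matrix ν ν ℂ :=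
  1 + (1 : Matrix ν ν ℂ).submatrix id g * (Q - 1) * (1 : Matrix ν ν ℂ).submatrix g id

theorem Matrix.one_submatrix_id_mul {ρ : Type*} (g : μ → ν) (U : Matrix ν ρ ℂ) :
    (1 : Matrix ν ν ℂ).submatrix g id * U = U.submatrix g id := by
  ext i j
  simp [Matrix.mul_apply, Matrix.one_apply]

theorem Matrix.extendOne_mul_submatrix {ρ : Type*} {g : μ → ν} (hg : Function.Injective g)
    (Q : Matrix μ μ ℂ) (U : Matrix ν ρ ℂ) :
    (Matrix.extendOne g Q * U).submatrix g id = Q * U.submatrix g id := by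
  rw [← Matrix.one_submatrix_id_mul, ← Matrix.one_submatrix_id_mul, Matrix.extendOne]
  have h : (1 : Matrix ν ν ℂ).submatrix g id * (1 : Matrix ν ν ℂ).submatrix id g = 1 := by
    rw [Matrix.one_submatrix_id_mul, Matrix.submatrix_submatrix]
    exact Matrix.submatrix_one g hg
  rw [Matrix.add_mul, Matrix.mul_add, Matrix.one_mul, ← Matrix.mul_assoc, ← Matrix.mul_assoc,
    ← Matrix.mul_assoc, Matrix.mul_one, h, Matrix.one_mul, Matrix.mul_assoc, Matrix.sub_mul,
    Matrix.one_mul, Matrix.one_submatrix_id_mul]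
  abel

theorem Matrix.extendOne_apply {g : μ → ν} (hg : Function.Injective g) (Q : Matrix μ μ ℂ)
    (i j : μ) : Matrix.extendOne g Q (g i) (g j) = Q i j := by
  have h := congrFun (congrFun (Matrix.extendOne_mul_submatrix hg Q 1) i) (g j)
  rw [Matrix.mul_one] at h
  refine h.trans ?_
  simp [Matrix.mul_apply, Matrix.one_apply, hg.eq_iff]

theorem Matrix.extendOne_apply_of_notMem (g : μ → ν) (Q : Matrix μ μ ℂ) {p q : ν}
    (h : p ∉ Set.range g ∨ q ∉ Set.range g) :
    Matrix.extendOne g Q p q = (1 : Matrix ν ν ℂ) p q := by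
  rw [Matrix.extendOne, Matrix.add_apply, add_eq_left, Matrix.mul_apply]
  refine Finset.sum_eq_zero fun j _ => ?_
  rw [Matrix.mul_apply]
  rcases h with h | h
  · rw [Finset.sum_eq_zero, zero_mul]
    intro i _
    rw [Matrix.submatrix_apply, Matrix.one_apply_ne, zero_mul]
    exact fun hi => h ⟨i, hi.symm⟩
  · rw [Matrix.submatrix_apply, Matrix.one_apply_ne, mul_zero]
    exact fun hi => h ⟨j, hi⟩

theorem Matrix.eq_extendOne {g : μ → ν} (hg : Function.Injective g) (M : Matrix ν ν ℂ)
    (Q : Matrix μ μ ℂ) (hQ : ∀ i j, M (g i) (g j) = Q i j)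
    (h : ∀ p q, p ∉ Set.range g ∨ q ∉ Set.range g → M p q = (1 : Matrix ν ν ℂ) p q) :
    M = Matrix.extendOne g Q := by
  ext p q
  by_cases hpq : p ∉ Set.range g ∨ q ∉ Set.range g
  · rw [h p q hpq, Matrix.extendOne_apply_of_notMem g Q hpq]
  · push Not at hpq
    obtain ⟨⟨i, rfl⟩, ⟨j, rfl⟩⟩ := hpq
    rw [hQ, Matrix.extendOne_apply hg]

theorem Matrix.extendOne_mul {g : μ → ν} (hg : Function.Injective g) (P Q : Matrix μ μ ℂ) :
    Matrix.extendOne g (P * Q) = Matrix.extendOne g P * Matrix.extendOne g Q := by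
  have h : (1 : Matrix ν ν ℂ).submatrix g id * (1 : Matrix ν ν ℂ).submatrix id g = 1 := by
    rw [Matrix.one_submatrix_id_mul, Matrix.submatrix_submatrix]
    exact Matrix.submatrix_one g hg
  simp only [Matrix.extendOne]
  set J := (1 : Matrix ν ν ℂ).submatrix id g
  set K := (1 : Matrix ν ν ℂ).submatrix g id
  have h2 : J * (P - 1) * K * (J * (Q - 1) * K) = J * ((P - 1) * (Q - 1)) * K := by
    rw [show J * (P - 1) * K * (J * (Q - 1) * K) = J * (P - 1) * (K * J) * (Q - 1) * K by
      simp only [Matrix.mul_assoc], h, Matrix.mul_one]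
    simp only [Matrix.mul_assoc]
  rw [show P * Q - 1 = (P - 1) * (Q - 1) + (P - 1) + (Q - 1) by noncomm_ring]
  rw [add_mul 1, one_mul, mul_add, mul_one, h2]
  simp only [Matrix.mul_add, Matrix.add_mul]
  abel

theorem Matrix.extendOne_conjTranspose (g : μ → ν) (Q : Matrix μ μ ℂ) :
    (Matrix.extendOne g Q)ᴴ = Matrix.extendOne g Qᴴ := by
  simp [Matrix.extendOne, Matrix.mul_assoc]

theorem Matrix.extendOne_mem_unitaryGroup {g : μ → ν} (hg : Function.Injective g)
    {Q : Matrix μ μ ℂ} (hQ : Q ∈ Matrix.unitaryGroup μ ℂ) :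
    Matrix.extendOne g Q ∈ Matrix.unitaryGroup ν ℂ := by
  rw [Matrix.mem_unitaryGroup_iff, Matrix.star_eq_conjTranspose] at *
  rw [Matrix.extendOne_conjTranspose, ← Matrix.extendOne_mul hg, hQ]
  simp [Matrix.extendOne]

theorem Matrix.apply_eq_one_of_apply_eq_one {U : Matrix ν ν ℂ}
    (hU : U ∈ Matrix.unitaryGroup ν ℂ) {q : ν}
    (h : ∀ p, U p q = (1 : Matrix ν ν ℂ) p q) (p : ν) : U q p = (1 : Matrix ν ν ℂ) q p := by
  have h1 := congrFun (congrFun (Matrix.mem_unitaryGroup_iff'.1 hU) p) q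
  rw [Matrix.mul_apply] at h1
  simp only [h, Matrix.star_apply, Matrix.one_apply, mul_ite, mul_one, mul_zero,
    Finset.sum_ite_eq', Finset.mem_univ, if_true] at h1
  rw [Matrix.one_apply, ← star_inj, h1]
  by_cases hpq : p = q
  · simp [hpq]
  · simp [hpq, Ne.symm hpq]

end Embedding

section Layers

variable {κ β : Type*} [Fintype κ] [DecidableEq κ] [Fintype β] [DecidableEq β]

/-- A unitary which is block diagonal with respect to the first tensor factor. -/
def IsCtrlFst (M : Matrix (κ × β) (κ × β) ℂ) : Prop :=
  M ∈ Matrix.unitaryGroup (κ × β) ℂ ∧ ∀ p q, p.1 ≠ q.1 → M p q = 0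

/-- A unitary which is block diagonal with respect to the second tensor factor. -/
def IsCtrlSnd (M : Matrix (κ × β) (κ × β) ℂ) : Prop :=
  M ∈ Matrix.unitaryGroup (κ × β) ℂ ∧ ∀ p q, p.2 ≠ q.2 → M p q = 0

/-- A matrix which agrees with the identity outside the levels of the first factor in `S`. -/
def ActsOn (S : Set κ) (M : Matrix (κ × β) (κ × β) ℂ) : Prop :=
  ∀ p q, p.1 ∉ S ∨ q.1 ∉ S → M p q = (1 : Matrix (κ × β) (κ × β) ℂ) p q

theorem IsCtrlFst.one : IsCtrlFst (1 : Matrix (κ × β) (κ × β) ℂ) :=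
  ⟨one_mem _, fun _ _ h => Matrix.one_apply_ne fun h' => h (congrArg Prod.fst h')⟩

theorem IsCtrlFst.mul {M N : Matrix (κ × β) (κ × β) ℂ} (hM : IsCtrlFst M) (hN : IsCtrlFst N) :
    IsCtrlFst (M * N) := by
  refine ⟨mul_mem hM.1 hN.1, fun p q hpq => ?_⟩
  rw [Matrix.mul_apply]
  refine Finset.sum_eq_zero fun r _ => ?_
  by_cases h : p.1 = r.1
  · rw [hN.2 r q (h ▸ hpq), mul_zero]
  · rw [hM.2 p r h, zero_mul]

theorem IsCtrlSnd.mul {M N : Matrix (κ × β) (κ × β) ℂ} (hM : IsCtrlSnd M) (hN : IsCtrlSnd N) :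
    IsCtrlSnd (M * N) := by
  refine ⟨mul_mem hM.1 hN.1, fun p q hpq => ?_⟩
  rw [Matrix.mul_apply]
  refine Finset.sum_eq_zero fun r _ => ?_
  by_cases h : p.2 = r.2
  · rw [hN.2 r q (h ▸ hpq), mul_zero]
  · rw [hM.2 p r h, zero_mul]

theorem IsCtrlFst.conjTranspose {M : Matrix (κ × β) (κ × β) ℂ} (hM : IsCtrlFst M) :
    IsCtrlFst Mᴴ :=
  ⟨Unitary.star_mem hM.1, fun p q hpq => by
    rw [Matrix.conjTranspose_apply, hM.2 q p hpq.symm, star_zero]⟩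

theorem ActsOn.one (S : Set κ) : ActsOn S (1 : Matrix (κ × β) (κ × β) ℂ) := fun _ _ _ => rfl

theorem ActsOn.mono {S T : Set κ} (hST : S ⊆ T) {M : Matrix (κ × β) (κ × β) ℂ}
    (hM : ActsOn S M) : ActsOn T M :=
  fun p q h => hM p q (h.imp (fun h h' => h (hST h')) (fun h h' => h (hST h')))

theorem ActsOn.conjTranspose {S : Set κ} {M : Matrix (κ × β) (κ × β) ℂ} (hM : ActsOn S M) :
    ActsOn S Mᴴ := by
  intro p q h
  rw [Matrix.conjTranspose_apply, hM q p h.symm, ← Matrix.conjTranspose_apply,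
    Matrix.conjTranspose_one]

theorem ActsOn.mul {S : Set κ} {M N : Matrix (κ × β) (κ × β) ℂ} (hM : ActsOn S M)
    (hN : ActsOn S N) : ActsOn S (M * N) := by
  intro p q h
  rcases h with h | h
  · rw [Matrix.mul_apply]
    simp only [hM p _ (Or.inl h), Matrix.one_apply, ite_mul, one_mul, zero_mul,
      Finset.sum_ite_eq, Finset.mem_univ, if_true]
    rw [hN p q (Or.inl h), Matrix.one_apply]
  · rw [Matrix.mul_apply]
    simp only [hN _ q (Or.inr h), Matrix.one_apply, mul_ite, mul_one, mul_zero,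
      Finset.sum_ite_eq', Finset.mem_univ, if_true]
    rw [hM p q (Or.inr h), Matrix.one_apply]

theorem ActsOn.mul_apply {ρ : Type*} {S : Set κ} {M : Matrix (κ × β) (κ × β) ℂ}
    (hM : ActsOn S M) (U : Matrix (κ × β) ρ ℂ) {p : κ × β} (hp : p.1 ∉ S) (q : ρ) :
    (M * U) p q = U p q := by
  rw [Matrix.mul_apply]
  simp only [hM p _ (Or.inl hp), Matrix.one_apply, ite_mul, one_mul, zero_mul,
    Finset.sum_ite_eq, Finset.mem_univ, if_true]

theorem ActsOn.commute {S T : Set κ} (hST : Disjoint S T) {M N : Matrix (κ × β) (κ × β) ℂ}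
    (hM : ActsOn S M) (hN : ActsOn T N) : Commute M N := by
  have key : ∀ {S T : Set κ}, Disjoint S T → ∀ {M N : Matrix (κ × β) (κ × β) ℂ},
      ActsOn S M → ActsOn T N → (M - 1) * (N - 1) = 0 := by
    intro S T hST M N hM hN
    ext p q
    rw [Matrix.mul_apply]
    refine Finset.sum_eq_zero fun r _ => ?_
    by_cases hr : r.1 ∈ S
    · rw [Matrix.sub_apply N, hN r q (Or.inl (hST.notMem_of_mem_left hr)), sub_self, mul_zero]
    · rw [Matrix.sub_apply M, hM p r (Or.inr hr), sub_self, zero_mul]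
  have h : (M - 1) * (N - 1) = (N - 1) * (M - 1) := by
    rw [key hST hM hN, key hST.symm hN hM]
  have h2 : M * N - N * M = (M - 1) * (N - 1) - (N - 1) * (M - 1) := by noncomm_ring
  rw [h, sub_self, sub_eq_zero] at h2
  exact h2

/-- The block diagonal matrix with blocks `V a` indexed by the first tensor factor. -/
def ctrlFst (V : κ → Matrix β β ℂ) : Matrix (κ × β) (κ × β) ℂ :=
  (Matrix.blockDiagonal V).submatrix Prod.swap Prod.swap

theorem ctrlFst_apply (V : κ → Matrix β β ℂ) (p q : κ × β) :
    ctrlFst V p q = if p.1 = q.1 then V p.1 p.2 q.2 else 0 := by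
  simp [ctrlFst, Matrix.blockDiagonal_apply]

theorem ctrlFst_mul (V W : κ → Matrix β β ℂ) :
    ctrlFst V * ctrlFst W = ctrlFst fun a => V a * W a := by
  rw [ctrlFst, ctrlFst, ctrlFst, Matrix.blockDiagonal_mul]
  exact Matrix.submatrix_mul_equiv _ _ Prod.swap (Equiv.prodComm κ β) Prod.swap

theorem ctrlFst_one : ctrlFst (fun _ => 1 : κ → Matrix β β ℂ) = 1 := by
  ext p q
  rw [ctrlFst_apply]
  by_cases h : p.1 = q.1 <;> simp [h, Matrix.one_apply, Prod.ext_iff]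

theorem ctrlFst_conjTranspose (V : κ → Matrix β β ℂ) :
    (ctrlFst V)ᴴ = ctrlFst fun a => (V a)ᴴ := by
  rw [ctrlFst, ctrlFst, Matrix.conjTranspose_submatrix, Matrix.blockDiagonal_conjTranspose]

theorem isCtrlFst_ctrlFst {V : κ → Matrix β β ℂ} (hV : ∀ a, V a ∈ Matrix.unitaryGroup β ℂ) :
    IsCtrlFst (ctrlFst V) := by
  refine ⟨?_, fun p q h => by rw [ctrlFst_apply, if_neg h]⟩
  rw [Matrix.mem_unitaryGroup_iff, Matrix.star_eq_conjTranspose, ctrlFst_conjTranspose,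
    ctrlFst_mul, ← ctrlFst_one]
  congr 1
  funext a
  exact Matrix.mem_unitaryGroup_iff.1 (hV a)

theorem isCtrlSnd_blockDiagonal {R : β → Matrix κ κ ℂ}
    (hR : ∀ b, R b ∈ Matrix.unitaryGroup κ ℂ) : IsCtrlSnd (Matrix.blockDiagonal R) := by
  refine ⟨?_, fun p q h => by rw [Matrix.blockDiagonal_apply, if_neg h]⟩
  rw [Matrix.mem_unitaryGroup_iff, Matrix.star_eq_conjTranspose,
    Matrix.blockDiagonal_conjTranspose, ← Matrix.blockDiagonal_mul, ← Matrix.blockDiagonal_one]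
  congr 1
  funext b
  exact Matrix.mem_unitaryGroup_iff.1 (hR b)

/-- The cosine-sine decomposition of a unitary on `ℂ² ⊗ ℂᵝ`. -/
theorem exists_cosine_sine_decomposition (Q : Matrix (Fin 2 × β) (Fin 2 × β) ℂ)
    (hQ : Q ∈ Matrix.unitaryGroup (Fin 2 × β) ℂ) :
    ∃ v c w : Matrix (Fin 2 × β) (Fin 2 × β) ℂ,
      IsCtrlFst v ∧ IsCtrlSnd c ∧ IsCtrlFst w ∧ Q = v * c * w := by
  let B : Fin 2 → Matrix β β ℂ := fun x => Q.submatrix (fun b => (x, b)) (fun b => (0, b))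
  have hB : (B 0)ᴴ * B 0 + (B 1)ᴴ * B 1 = 1 := by
    ext b b'
    have h := congrFun (congrFun (Matrix.mem_unitaryGroup_iff'.1 hQ) (0, b)) (0, b')
    rw [Matrix.mul_apply, Fintype.sum_prod_type, Fin.sum_univ_two] at h
    simpa [Matrix.mul_apply, B, Matrix.one_apply] using h
  have hH : ((B 0)ᴴ * B 0).IsHermitian := Matrix.isHermitian_conjTranspose_mul_self _
  obtain ⟨W, hW, d, hs⟩ : ∃ W ∈ Matrix.unitaryGroup β ℂ, ∃ d : β → ℂ,
      (B 0)ᴴ * B 0 = W * Matrix.diagonal d * Wᴴ :=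
    ⟨_, hH.eigenvectorUnitary.2, _, hH.spectral_theorem⟩
  have hWW : W * Wᴴ = 1 := Matrix.mem_unitaryGroup_iff.1 hW
  have hWW' : Wᴴ * W = 1 := Matrix.mem_unitaryGroup_iff'.1 hW
  have h0 : (B 0 * W)ᴴ * (B 0 * W) = Matrix.diagonal d := by
    rw [Matrix.conjTranspose_mul, Matrix.mul_assoc, ← Matrix.mul_assoc (B 0)ᴴ, hs]
    simp only [Matrix.mul_assoc, hWW', Matrix.mul_one]
    rw [← Matrix.mul_assoc, hWW', Matrix.one_mul]
  have h01 : (B 0 * W)ᴴ * (B 0 * W) + (B 1 * W)ᴴ * (B 1 * W) = 1 := by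
    have : (B 0 * W)ᴴ * (B 0 * W) + (B 1 * W)ᴴ * (B 1 * W)
        = Wᴴ * ((B 0)ᴴ * B 0 + (B 1)ᴴ * B 1) * W := by
      simp only [Matrix.conjTranspose_mul, Matrix.mul_add, Matrix.add_mul, Matrix.mul_assoc]
    rw [this, hB, Matrix.mul_one, hWW']
  have h1 : (B 1 * W)ᴴ * (B 1 * W) =
      Matrix.diagonal (fun b => 1 - d b) := by
    rw [← Matrix.diagonal_sub, ← h0, Matrix.diagonal_one, ← h01]
    abel
  obtain ⟨V0, hV0, c, hc⟩ := (B 0 * W).exists_unitary_mul_diagonal _ h0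
  obtain ⟨V1, hV1, s, hs1⟩ := (B 1 * W).exists_unitary_mul_diagonal _ h1
  have hcs : ∀ b, (c b : ℂ) * c b + (s b : ℂ) * s b = 1 := by
    intro b
    rw [hc, hs1] at h01
    simp only [Matrix.conjTranspose_mul, Matrix.mul_assoc] at h01
    rw [← Matrix.mul_assoc V0ᴴ, ← Matrix.mul_assoc V1ᴴ,
      ← Matrix.star_eq_conjTranspose V0, ← Matrix.star_eq_conjTranspose V1,
      Matrix.mem_unitaryGroup_iff'.1 hV0, Matrix.mem_unitaryGroup_iff'.1 hV1] at h01
    have := congrFun (congrFun h01 b) b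
    simpa using this
  let V : Fin 2 → Matrix β β ℂ := ![V0, V1]
  have hV : ∀ x, V x ∈ Matrix.unitaryGroup β ℂ := by
    intro x; fin_cases x <;> assumption
  let R : β → Matrix (Fin 2) (Fin 2) ℂ := fun b => !![(c b : ℂ), -s b; s b, c b]
  have hR : ∀ b, R b ∈ Matrix.unitaryGroup (Fin 2) ℂ := by
    intro b
    rw [Matrix.mem_unitaryGroup_iff]
    ext x y
    fin_cases x <;> fin_cases y <;>
      simp [R, Matrix.mul_apply, Fin.sum_univ_two, Matrix.star_apply] <;>
      first | ring1 | linear_combination hcs b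
  let E : Fin 2 → Matrix β β ℂ := ![W, 1]
  have hE : ∀ x, E x ∈ Matrix.unitaryGroup β ℂ := by
    intro x; fin_cases x
    · exact hW
    · exact one_mem _
  have hv := isCtrlFst_ctrlFst hV
  have hk := isCtrlSnd_blockDiagonal hR
  have he := isCtrlFst_ctrlFst hE
  set P := ctrlFst V * Matrix.blockDiagonal R with hP
  have hPu : P ∈ Matrix.unitaryGroup (Fin 2 × β) ℂ := mul_mem hv.1 hk.1
  have hcol : ∀ p b, (Q * ctrlFst E) p (0, b) = P p (0, b) := by
    rintro ⟨x, a⟩ b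
    have h3 : (B x * W) a b = (V x * Matrix.diagonal fun b => (R b x 0)) a b := by
      fin_cases x
      · exact congrFun (congrFun hc a) b
      · exact congrFun (congrFun hs1 a) b
    rw [Matrix.mul_diagonal, Matrix.mul_apply] at h3
    rw [hP, Matrix.mul_apply, Matrix.mul_apply]
    simp only [Fintype.sum_prod_type_right, ctrlFst_apply, Matrix.blockDiagonal_apply]
    simpa [Finset.sum_ite_eq, E, B] using h3
  let Z := Pᴴ * (Q * ctrlFst E)
  have hZu : Z ∈ Matrix.unitaryGroup (Fin 2 × β) ℂ :=
    mul_mem (Unitary.star_mem hPu) (mul_mem hQ he.1)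
  have hZ0 : ∀ p b, Z p (0, b) = (1 : Matrix (Fin 2 × β) (Fin 2 × β) ℂ) p (0, b) := by
    intro p b
    change (Pᴴ * (Q * ctrlFst E)) p (0, b) = _
    rw [← Matrix.mem_unitaryGroup_iff'.1 hPu, Matrix.star_eq_conjTranspose, Matrix.mul_apply,
      Matrix.mul_apply]
    exact Finset.sum_congr rfl fun r _ => by rw [hcol]
  have hZ : IsCtrlFst Z := by
    refine ⟨hZu, ?_⟩
    rintro ⟨x, a⟩ ⟨y, b⟩ hxy
    have hne : ((x, a) : Fin 2 × β) ≠ (y, b) := fun h => hxy (congrArg Prod.fst h)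
    by_cases hy : y = 0
    · subst hy
      rw [hZ0, Matrix.one_apply_ne hne]
    · have hx : x = 0 := by
        have : x ≠ y := hxy
        omega
      subst hx
      rw [Matrix.apply_eq_one_of_apply_eq_one hZu (fun p => hZ0 p a), Matrix.one_apply_ne hne]
  refine ⟨ctrlFst V, Matrix.blockDiagonal R, Z * (ctrlFst E)ᴴ, hv, hk,
    hZ.mul he.conjTranspose, ?_⟩
  have hPP : P * Pᴴ = 1 := Matrix.mem_unitaryGroup_iff.1 hPu
  have hEE : ctrlFst E * (ctrlFst E)ᴴ = 1 := Matrix.mem_unitaryGroup_iff.1 he.1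
  rw [← hP, ← Matrix.mul_assoc, ← Matrix.mul_assoc, hPP, Matrix.one_mul, Matrix.mul_assoc, hEE,
    Matrix.mul_one]

end Layers

section Triangular

variable {n : ℕ} {β : Type*} [Fintype β] [DecidableEq β]

/-- A unitary acting on the adjacent levels `m` and `m + 1` of the first factor. -/
def IsTwoLevel (m : ℕ) (T : Matrix (Fin n × β) (Fin n × β) ℂ) : Prop :=
  m + 1 < n ∧ T ∈ Matrix.unitaryGroup (Fin n × β) ℂ ∧
    ActsOn {i : Fin n | i.val = m ∨ i.val = m + 1} T

/-- An alternating product of `s + 1` unitaries controlled by the first factor and `s` unitaries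
controlled by the second one, where the `t`-th pair acts only on the levels below `p + t`. -/
inductive IsLayered : ℕ → ℕ → Matrix (Fin n × β) (Fin n × β) ℂ → Prop
  | single {p : ℕ} {a : Matrix (Fin n × β) (Fin n × β) ℂ} (ha : IsCtrlFst a)
      (hap : ActsOn {i : Fin n | i.val < p} a) : IsLayered p 0 a
  | cons {p s : ℕ} {a b M : Matrix (Fin n × β) (Fin n × β) ℂ} (ha : IsCtrlFst a)
      (hap : ActsOn {i : Fin n | i.val < p} a) (hb : IsCtrlSnd b)
      (hbp : ActsOn {i : Fin n | i.val < p} b) (hM : IsLayered (p + 1) s M) :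
      IsLayered p (s + 1) (a * b * M)

/-- A product of two-level unitaries on the levels `m, m + 1`, then `m + 1, m + 2`, up to
`k - 1, k`, times a unitary on level `k`. -/
inductive IsStaircase (k : ℕ) : ℕ → Matrix (Fin n × β) (Fin n × β) ℂ → Prop
  | single {D : Matrix (Fin n × β) (Fin n × β) ℂ} (hD : IsCtrlFst D)
      (hDk : ActsOn {i : Fin n | i.val = k} D) : IsStaircase k k D
  | cons {m : ℕ} {T M : Matrix (Fin n × β) (Fin n × β) ℂ} (hT : IsTwoLevel m T)
      (hM : IsStaircase k (m + 1) M) : IsStaircase k m (T * M)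

theorem IsLayered.mono {p s : ℕ} {M : Matrix (Fin n × β) (Fin n × β) ℂ} (hM : IsLayered p s M) :
    ∀ {p' : ℕ}, p ≤ p' → IsLayered p' s M := by
  induction hM with
  | single ha hap =>
    intro p' hp
    exact .single ha (hap.mono fun i hi => lt_of_lt_of_le hi hp)
  | cons ha hap hb hbp _ ih =>
    intro p' hp
    exact .cons ha (hap.mono fun i hi => lt_of_lt_of_le hi hp) hb
      (hbp.mono fun i hi => lt_of_lt_of_le hi hp) (ih (by omega))

theorem IsLayered.mul_left {p s : ℕ} {a M : Matrix (Fin n × β) (Fin n × β) ℂ}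
    (hM : IsLayered p s M) (ha : IsCtrlFst a) (hap : ActsOn {i : Fin n | i.val < p} a) :
    IsLayered p s (a * M) := by
  cases hM with
  | single ha' hap' => exact .single (ha.mul ha') (hap.mul hap')
  | cons ha' hap' hb hbp hM =>
    rw [← Matrix.mul_assoc, ← Matrix.mul_assoc]
    exact .cons (ha.mul ha') (hap.mul hap') hb hbp hM

theorem range_prodMap_id {κ : Type*} (f : Fin 2 → κ) (p : κ × β) :
    p ∈ Set.range (Prod.map f (id : β → β)) ↔ p.1 ∈ Set.range f := by
  rw [Set.range_prodMap]
  simp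

theorem adjacentLevels_injective {m : ℕ} (hm : m + 1 < n) :
    Function.Injective (![⟨m, by omega⟩, ⟨m + 1, hm⟩] : Fin 2 → Fin n) := by
  intro i j h
  fin_cases i <;> fin_cases j <;> simp_all

theorem mem_range_adjacentLevels {m : ℕ} (hm : m + 1 < n) (i : Fin n) :
    i ∈ Set.range (![⟨m, by omega⟩, ⟨m + 1, hm⟩] : Fin 2 → Fin n) ↔
      i.val = m ∨ i.val = m + 1 := by
  simp [Fin.ext_iff, or_comm]

theorem IsCtrlFst.extendOne {κ : Type*} [Fintype κ] [DecidableEq κ] {f : Fin 2 → κ}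
    (hf : Function.Injective f) {M : Matrix (Fin 2 × β) (Fin 2 × β) ℂ} (hM : IsCtrlFst M) :
    IsCtrlFst (Matrix.extendOne (Prod.map f id) M) := by
  have hg : Function.Injective (Prod.map f (id : β → β)) := hf.prodMap Function.injective_id
  refine ⟨Matrix.extendOne_mem_unitaryGroup hg hM.1, fun p q hpq => ?_⟩
  by_cases h : p ∉ Set.range (Prod.map f (id : β → β)) ∨ q ∉ Set.range (Prod.map f (id : β → β))
  · rw [Matrix.extendOne_apply_of_notMem _ _ h, Matrix.one_apply_ne]
    exact fun h => hpq (congrArg Prod.fst h)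
  · push Not at h
    obtain ⟨⟨i, rfl⟩, ⟨j, rfl⟩⟩ := h
    rw [Matrix.extendOne_apply hg]
    exact hM.2 i j fun h => hpq (congrArg f h)

theorem IsCtrlSnd.extendOne {κ : Type*} [Fintype κ] [DecidableEq κ] {f : Fin 2 → κ}
    (hf : Function.Injective f) {M : Matrix (Fin 2 × β) (Fin 2 × β) ℂ} (hM : IsCtrlSnd M) :
    IsCtrlSnd (Matrix.extendOne (Prod.map f id) M) := by
  have hg : Function.Injective (Prod.map f (id : β → β)) := hf.prodMap Function.injective_id
  refine ⟨Matrix.extendOne_mem_unitaryGroup hg hM.1, fun p q hpq => ?_⟩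
  by_cases h : p ∉ Set.range (Prod.map f (id : β → β)) ∨ q ∉ Set.range (Prod.map f (id : β → β))
  · rw [Matrix.extendOne_apply_of_notMem _ _ h, Matrix.one_apply_ne]
    exact fun h => hpq (congrArg Prod.snd h)
  · push Not at h
    obtain ⟨⟨i, rfl⟩, ⟨j, rfl⟩⟩ := h
    rw [Matrix.extendOne_apply hg]
    exact hM.2 i j hpq

theorem actsOn_extendOne {m : ℕ} (hm : m + 1 < n) (Q : Matrix (Fin 2 × β) (Fin 2 × β) ℂ) :
    ActsOn {i : Fin n | i.val = m ∨ i.val = m + 1}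
      (Matrix.extendOne (Prod.map ![⟨m, by omega⟩, ⟨m + 1, hm⟩] id) Q) := by
  intro p q h
  refine Matrix.extendOne_apply_of_notMem _ _ (h.imp ?_ ?_) <;>
  · intro h h'
    rw [range_prodMap_id, mem_range_adjacentLevels] at h'
    exact h h'

theorem IsTwoLevel.exists_decomposition {m : ℕ} {T : Matrix (Fin n × β) (Fin n × β) ℂ}
    (hT : IsTwoLevel m T) : ∃ v c w : Matrix (Fin n × β) (Fin n × β) ℂ,
      (IsCtrlFst v ∧ ActsOn {i : Fin n | i.val = m ∨ i.val = m + 1} v) ∧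
      (IsCtrlSnd c ∧ ActsOn {i : Fin n | i.val = m ∨ i.val = m + 1} c) ∧
      (IsCtrlFst w ∧ ActsOn {i : Fin n | i.val = m ∨ i.val = m + 1} w) ∧ T = v * c * w := by
  obtain ⟨hm, hTu, hTa⟩ := hT
  have hf := adjacentLevels_injective hm
  have hg : Function.Injective (Prod.map (![⟨m, by omega⟩, ⟨m + 1, hm⟩] : Fin 2 → Fin n)
      (id : β → β)) := hf.prodMap Function.injective_id
  set g := Prod.map (![⟨m, by omega⟩, ⟨m + 1, hm⟩] : Fin 2 → Fin n) (id : β → β) with hgdef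
  have hTe : T = Matrix.extendOne g (T.submatrix g g) := by
    refine Matrix.eq_extendOne hg T _ (fun i j => rfl) fun p q h => hTa p q (h.imp ?_ ?_) <;>
    · intro h h'
      exact h ((range_prodMap_id _ _).2 ((mem_range_adjacentLevels hm _).2 h'))
  have hQ : T.submatrix g g ∈ Matrix.unitaryGroup (Fin 2 × β) ℂ := by
    rw [Matrix.mem_unitaryGroup_iff, Matrix.star_eq_conjTranspose] at *
    rw [hTe, Matrix.extendOne_conjTranspose, ← Matrix.extendOne_mul hg] at hTu
    ext i j
    have := congrFun (congrFun hTu (g i)) (g j)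
    rw [Matrix.extendOne_apply hg] at this
    rw [this, Matrix.one_apply, Matrix.one_apply]
    simp only [hg.eq_iff]
  obtain ⟨v, c, w, hv, hc, hw, h⟩ := exists_cosine_sine_decomposition _ hQ
  refine ⟨Matrix.extendOne g v, Matrix.extendOne g c, Matrix.extendOne g w,
    ⟨hv.extendOne hf, actsOn_extendOne hm v⟩, ⟨hc.extendOne hf, actsOn_extendOne hm c⟩,
    ⟨hw.extendOne hf, actsOn_extendOne hm w⟩, ?_⟩
  rw [← Matrix.extendOne_mul hg, ← Matrix.extendOne_mul hg, ← h, ← hTe]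

theorem IsLayered.twoLevel_mul {m s : ℕ} {T M : Matrix (Fin n × β) (Fin n × β) ℂ}
    (hT : IsTwoLevel m T) (hM : IsLayered (m + 3) s M) : IsLayered (m + 2) (s + 1) (T * M) := by
  obtain ⟨v, c, w, ⟨hv, hvm⟩, ⟨hc, hcm⟩, ⟨hw, hwm⟩, rfl⟩ := hT.exists_decomposition
  rw [Matrix.mul_assoc (v * c)]
  have h : ∀ {p}, m + 2 ≤ p → {i : Fin n | i.val = m ∨ i.val = m + 1} ⊆ {i | i.val < p} := by
    intro p hp i hi
    rcases hi with hi | hi <;> simp only [Set.mem_ofPred_eq] <;> omega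
  exact .cons hv (hvm.mono (h le_rfl)) hc (hcm.mono (h le_rfl))
    (hM.mul_left hw (hwm.mono (h (by omega))))

theorem IsStaircase.le {k m : ℕ} {M : Matrix (Fin n × β) (Fin n × β) ℂ}
    (hM : IsStaircase k m M) : m ≤ k := by
  induction hM with
  | single => exact le_rfl
  | cons _ _ ih => omega

theorem IsStaircase.actsOn {k m : ℕ} {M : Matrix (Fin n × β) (Fin n × β) ℂ}
    (hM : IsStaircase k m M) : ActsOn {i : Fin n | m ≤ i.val} M := by
  induction hM with
  | single _ hD => exact hD.mono fun i hi => le_of_eq (Eq.symm hi)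
  | cons hT _ ih =>
    refine ActsOn.mul (hT.2.2.mono fun i hi => ?_) (ih.mono fun i hi => ?_) <;>
    · simp only [Set.mem_ofPred_eq] at *
      omega

theorem IsStaircase.mul_isLayered {k m : ℕ} {M : Matrix (Fin n × β) (Fin n × β) ℂ}
    (hM : IsStaircase k m M) : ∀ {s : ℕ} {V : Matrix (Fin n × β) (Fin n × β) ℂ},
      IsLayered m s V → k ≤ m + s → IsLayered (m + 2) s (M * V) := by
  induction hM with
  | single hD hDk =>
    intro s V hV _
    refine (hV.mono (by omega)).mul_left hD (hDk.mono fun i hi => ?_)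
    simp only [Set.mem_ofPred_eq] at *
    omega
  | @cons m T M hT hM ih =>
    intro s V hV hs
    cases hV with
    | single => have := hM.le; omega
    | @cons _ s a b V ha ham hb hbm hV =>
      obtain ⟨v, c, w, ⟨hv, hvm⟩, ⟨hc, hcm⟩, ⟨hw, hwm⟩, rfl⟩ := hT.exists_decomposition
      have hd1 : Disjoint {i : Fin n | m + 1 ≤ i.val} {i | i.val < m} := by
        rw [Set.disjoint_left]
        intro i hi hi'
        simp only [Set.mem_ofPred_eq] at *
        omega
      have hd2 : Disjoint {i : Fin n | i.val = m ∨ i.val = m + 1} {i | i.val < m} := by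
        rw [Set.disjoint_left]
        intro i hi hi'
        simp only [Set.mem_ofPred_eq] at *
        omega
      have hMab : M * (a * b) = a * b * M := hM.actsOn.commute hd1 (ham.mul hbm)
      have hwab : w * (a * b) = a * b * w := hwm.commute hd2 (ham.mul hbm)
      have hca : c * a = a * c := hcm.commute hd2 ham
      have heq : v * c * w * M * (a * b * V) = (v * a) * (c * b) * (w * (M * V)) := by
        calc v * c * w * M * (a * b * V) = v * c * w * (M * (a * b)) * V := by
              simp only [Matrix.mul_assoc]
          _ = v * c * (w * (a * b)) * M * V := by rw [hMab]; simp only [Matrix.mul_assoc]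
          _ = v * (c * a) * b * w * M * V := by rw [hwab]; simp only [Matrix.mul_assoc]
          _ = _ := by rw [hca]; simp only [Matrix.mul_assoc]
      rw [heq]
      have h : ∀ {p}, m + 2 ≤ p → {i : Fin n | i.val = m ∨ i.val = m + 1} ⊆ {i | i.val < p} := by
        intro p hp i hi
        rcases hi with hi | hi <;> simp only [Set.mem_ofPred_eq] <;> omega
      have h' : {i : Fin n | i.val < m} ⊆ {i | i.val < m + 2} := fun i hi => by
        simp only [Set.mem_ofPred_eq] at *
        omega
      exact .cons (hv.mul ha) ((hvm.mono (h le_rfl)).mul (ham.mono h')) (hc.mul hb)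
        ((hcm.mono (h le_rfl)).mul (hbm.mono h'))
        ((ih hV (by omega)).mul_left hw (hwm.mono (h (by omega))))

theorem exists_twoLevel_mul_apply_zero {m : ℕ} (hm : m + 1 < n)
    (X : Matrix (Fin n × β) β ℂ) : ∃ T : Matrix (Fin n × β) (Fin n × β) ℂ,
      IsTwoLevel m T ∧ ∀ b b', (T * X) (⟨m, by omega⟩, b) b' = 0 := by
  have hf := adjacentLevels_injective hm
  have hg : Function.Injective (Prod.map (![⟨m, by omega⟩, ⟨m + 1, hm⟩] : Fin 2 → Fin n)
      (id : β → β)) := hf.prodMap Function.injective_id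
  set g := Prod.map (![⟨m, by omega⟩, ⟨m + 1, hm⟩] : Fin 2 → Fin n) (id : β → β) with hgdef
  obtain ⟨Q, hQ, h0⟩ := (X.submatrix g id).exists_unitary_mul_apply_zero
  refine ⟨Matrix.extendOne g Q, ⟨hm, Matrix.extendOne_mem_unitaryGroup hg hQ,
    actsOn_extendOne hm Q⟩, fun b b' => ?_⟩
  rw [← h0 b b', ← Matrix.extendOne_mul_submatrix hg]
  rfl

theorem IsTwoLevel.conjTranspose {m : ℕ} {T : Matrix (Fin n × β) (Fin n × β) ℂ}
    (hT : IsTwoLevel m T) : IsTwoLevel m Tᴴ :=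
  ⟨hT.1, Unitary.star_mem hT.2.1, hT.2.2.conjTranspose⟩

theorem exists_level_mul {j : ℕ} (hj : j < n) {U : Matrix (Fin n × β) (Fin n × β) ℂ}
    (hU : U ∈ Matrix.unitaryGroup (Fin n × β) ℂ) (hUj : ActsOn {i : Fin n | i.val < j + 1} U)
    (h0 : ∀ p : Fin n × β, p.1.val < j → ∀ b, U p (⟨j, hj⟩, b) = 0) :
    ∃ D U' : Matrix (Fin n × β) (Fin n × β) ℂ, IsCtrlFst D ∧
      ActsOn {i : Fin n | i.val = j} D ∧ U' ∈ Matrix.unitaryGroup (Fin n × β) ℂ ∧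
      ActsOn {i : Fin n | i.val < j} U' ∧ U = D * U' := by
  let g : β → Fin n × β := fun b => (⟨j, hj⟩, b)
  have hg : Function.Injective g := fun b b' h => congrArg Prod.snd h
  have hrange : ∀ p : Fin n × β, p ∈ Set.range g ↔ p.1.val = j := by
    rintro ⟨i, b⟩
    simp [g, Fin.ext_iff, eq_comm]
  have hcol : ∀ p : Fin n × β, p.1.val ≠ j → ∀ b, U p (g b) = 0 := by
    intro p hp b
    rcases lt_or_gt_of_ne hp with h | h
    · exact h0 p h b
    · rw [hUj p (g b) (Or.inl (by simp only [Set.mem_ofPred_eq]; omega)), Matrix.one_apply_ne]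
      rintro rfl
      exact hp rfl
  have hX : U.submatrix g g ∈ Matrix.unitaryGroup β ℂ := by
    rw [Matrix.mem_unitaryGroup_iff']
    ext b b'
    have h := congrFun (congrFun (Matrix.mem_unitaryGroup_iff'.1 hU) (g b)) (g b')
    rw [Matrix.mul_apply, Fintype.sum_prod_type, Finset.sum_eq_single ⟨j, hj⟩] at h
    · rw [Matrix.mul_apply, Matrix.one_apply]
      rw [Matrix.one_apply] at h
      simp only [hg.eq_iff] at h
      exact h
    · intro i _ hi
      refine Finset.sum_eq_zero fun b'' _ => ?_
      rw [hcol (i, b'') (fun h => hi (Fin.ext h)), mul_zero]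
    · simp
  have hDu := Matrix.extendOne_mem_unitaryGroup hg hX
  set D := Matrix.extendOne g (U.submatrix g g) with hD
  have hDj : ActsOn {i : Fin n | i.val = j} D := by
    intro p q h
    exact Matrix.extendOne_apply_of_notMem _ _ (h.imp (fun h h' => h ((hrange _).1 h'))
      (fun h h' => h ((hrange _).1 h')))
  have hDc : IsCtrlFst D := by
    refine ⟨hDu, fun p q hpq => ?_⟩
    rw [hDj p q, Matrix.one_apply_ne fun h => hpq (congrArg Prod.fst h)]
    by_contra! h
    exact hpq (Fin.ext (h.1.trans h.2.symm))
  have hDU : ∀ p b, U p (g b) = D p (g b) := by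
    intro p b
    by_cases hp : p.1.val = j
    · obtain ⟨a, rfl⟩ := (hrange p).2 hp
      rw [hD, Matrix.extendOne_apply hg, Matrix.submatrix_apply]
    · rw [hcol p hp, hDj p _ (Or.inl hp), Matrix.one_apply_ne]
      rintro rfl
      exact hp rfl
  have hU'u : Dᴴ * U ∈ Matrix.unitaryGroup (Fin n × β) ℂ := mul_mem (Unitary.star_mem hDu) hU
  have hU'c : ∀ b p, (Dᴴ * U) p (g b) = (1 : Matrix (Fin n × β) (Fin n × β) ℂ) p (g b) := by
    intro b p
    rw [← Matrix.mem_unitaryGroup_iff'.1 hDu, Matrix.star_eq_conjTranspose, Matrix.mul_apply,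
      Matrix.mul_apply]
    exact Finset.sum_congr rfl fun r _ => by rw [hDU]
  have hU'j : ActsOn {i : Fin n | i.val < j + 1} (Dᴴ * U) :=
    (hDj.conjTranspose.mono fun i hi => by simp only [Set.mem_ofPred_eq] at *; omega).mul hUj
  refine ⟨D, Dᴴ * U, hDc, hDj, hU'u, fun p q h => ?_, ?_⟩
  · by_cases hq : q.1.val = j
    · obtain ⟨b, rfl⟩ := (hrange q).2 hq
      exact hU'c b p
    by_cases hp : p.1.val = j
    · obtain ⟨b, rfl⟩ := (hrange p).2 hp
      exact Matrix.apply_eq_one_of_apply_eq_one hU'u (hU'c b) q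
    · refine hU'j p q (h.imp ?_ ?_) <;>
      · simp only [Set.mem_ofPred_eq]
        omega
  · rw [← Matrix.mul_assoc, ← Matrix.star_eq_conjTranspose, Matrix.mem_unitaryGroup_iff.1 hDu,
      Matrix.one_mul]

theorem exists_staircase_mul {j : ℕ} (hj : j < n) (d : ℕ) : ∀ {m : ℕ}, m + d = j →
    ∀ {U : Matrix (Fin n × β) (Fin n × β) ℂ}, U ∈ Matrix.unitaryGroup (Fin n × β) ℂ →
      ActsOn {i : Fin n | i.val < j + 1} U →
      (∀ p : Fin n × β, p.1.val < m → ∀ b, U p (⟨j, hj⟩, b) = 0) →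
      ∃ M U' : Matrix (Fin n × β) (Fin n × β) ℂ, IsStaircase j m M ∧
        U' ∈ Matrix.unitaryGroup (Fin n × β) ℂ ∧ ActsOn {i : Fin n | i.val < j} U' ∧
        U = M * U' := by
  induction d with
  | zero =>
    rintro m rfl U hU hUj h0
    obtain ⟨D, U', hD, hDj, hU', hU'j, h⟩ := exists_level_mul hj hU hUj h0
    exact ⟨D, U', .single hD hDj, hU', hU'j, h⟩
  | succ d ih =>
    intro m hm U hU hUj h0
    obtain ⟨T, hT, hT0⟩ := exists_twoLevel_mul_apply_zero (n := n) (m := m) (by omega)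
      (U.submatrix id fun b => ((⟨j, hj⟩, b) : Fin n × β))
    have hTU : ActsOn {i : Fin n | i.val < j + 1} (T * U) :=
      (hT.2.2.mono fun i hi => by simp only [Set.mem_ofPred_eq] at *; omega).mul hUj
    obtain ⟨M, U', hM, hU', hU'j, h⟩ := ih (m := m + 1) (by omega) (mul_mem hT.2.1 hU) hTU (by
      rintro ⟨i, a⟩ hp b
      by_cases hi : i.val = m
      · have h := hT0 a b
        rw [← show i = ⟨m, by omega⟩ from Fin.ext hi] at h
        exact h
      · simp only at hp
        rw [hT.2.2.mul_apply U (by simp only [Set.mem_ofPred_eq]; omega)]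
        exact h0 _ (by simp only; omega) b)
    refine ⟨Tᴴ * M, U', .cons hT.conjTranspose hM, hU', hU'j, ?_⟩
    rw [Matrix.mul_assoc, ← h, ← Matrix.mul_assoc, ← Matrix.star_eq_conjTranspose,
      Matrix.mem_unitaryGroup_iff'.1 hT.2.1, Matrix.one_mul]

theorem isLayered_of_actsOn (k : ℕ) (hk : k + 1 < n) : ∀ {U : Matrix (Fin n × β) (Fin n × β) ℂ},
    U ∈ Matrix.unitaryGroup (Fin n × β) ℂ → ActsOn {i : Fin n | i.val < k + 2} U →
      IsLayered 2 (2 * k + 1) U := by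
  induction k with
  | zero =>
    intro U hU hUa
    rw [← Matrix.mul_one U]
    refine IsLayered.twoLevel_mul ⟨hk, hU, hUa.mono fun i hi => ?_⟩
      (.single IsCtrlFst.one (ActsOn.one _))
    simp only [Set.mem_ofPred_eq] at *
    omega
  | succ k ih =>
    intro U hU hUa
    obtain ⟨M, U', hM, hU', hU'a, rfl⟩ := exists_staircase_mul (j := k + 2) (by omega) (k + 2)
      (m := 0) (by omega) hU hUa (by simp)
    have hL := ih (by omega) hU' hU'a
    cases hM with
    | cons hT0 hM =>
      cases hM with
      | cons hT1 hM =>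
        rw [Matrix.mul_assoc, Matrix.mul_assoc, show 2 * (k + 1) + 1 = 2 * k + 1 + 1 + 1 by ring]
        exact .twoLevel_mul hT0 (.twoLevel_mul hT1 (hM.mul_isLayered hL (by omega)))

end Triangular

section Circuits

variable {dA dB : ℕ}

/-- A product `L₀ G₁ L₁ ⋯ G_k L_k` of local unitaries and `k` standard gates. -/
inductive IsCircuit : ℕ → Matrix (Fin dA × Fin dB) (Fin dA × Fin dB) ℂ → Prop
  | loc {L : Matrix (Fin dA × Fin dB) (Fin dA × Fin dB) ℂ} (hL : IsLocalUnitary L) :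
      IsCircuit 0 L
  | cons {k : ℕ} {L G M : Matrix (Fin dA × Fin dB) (Fin dA × Fin dB) ℂ}
      (hL : IsLocalUnitary L) (hG : IsStdGate G) (hM : IsCircuit k M) :
      IsCircuit (k + 1) (L * G * M)

theorem IsLocalUnitary.mul {L M : Matrix (Fin dA × Fin dB) (Fin dA × Fin dB) ℂ}
    (hL : IsLocalUnitary L) (hM : IsLocalUnitary M) : IsLocalUnitary (L * M) := by
  obtain ⟨X, Y, hX, hY, rfl⟩ := hL
  obtain ⟨X', Y', hX', hY', rfl⟩ := hM
  exact ⟨X * X', Y * Y', mul_mem hX hX', mul_mem hY hY', (Matrix.mul_kronecker_mul _ _ _ _).symm⟩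

theorem IsLocalUnitary.one :
    IsLocalUnitary (1 : Matrix (Fin dA × Fin dB) (Fin dA × Fin dB) ℂ) :=
  ⟨1, 1, one_mem _, one_mem _, Matrix.one_kronecker_one.symm⟩

theorem IsStdGate.isCircuit {G : Matrix (Fin dA × Fin dB) (Fin dA × Fin dB) ℂ}
    (hG : IsStdGate G) : IsCircuit 1 G := by
  have := IsCircuit.cons .one hG (.loc .one)
  rwa [Matrix.one_mul, Matrix.mul_one] at this

theorem IsCircuit.mul {j k : ℕ} {M N : Matrix (Fin dA × Fin dB) (Fin dA × Fin dB) ℂ}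
    (hM : IsCircuit j M) (hN : IsCircuit k N) : IsCircuit (j + k) (M * N) := by
  induction hM with
  | loc hL =>
    rw [Nat.zero_add]
    cases hN with
    | loc hL' => exact .loc (hL.mul hL')
    | cons hL' hG hM =>
      rw [← Matrix.mul_assoc, ← Matrix.mul_assoc]
      exact .cons (hL.mul hL') hG hM
  | @cons j _ _ _ hL hG _ ih =>
    rw [Matrix.mul_assoc, show j + 1 + k = j + k + 1 by ring]
    exact .cons hL hG ih

theorem swap_mul (M N : Matrix (Fin dA × Fin dB) (Fin dA × Fin dB) ℂ) :
    (M * N).submatrix (Prod.swap : Fin dB × Fin dA → _) (Prod.swap : Fin dB × Fin dA → _) =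
      M.submatrix Prod.swap Prod.swap * N.submatrix Prod.swap Prod.swap :=
  (Matrix.submatrix_mul_equiv M N Prod.swap (Equiv.prodComm (Fin dB) (Fin dA)) Prod.swap).symm

theorem swap_mem_unitaryGroup {M : Matrix (Fin dA × Fin dB) (Fin dA × Fin dB) ℂ}
    (hM : M ∈ Matrix.unitaryGroup (Fin dA × Fin dB) ℂ) :
    M.submatrix Prod.swap Prod.swap ∈ Matrix.unitaryGroup (Fin dB × Fin dA) ℂ := by
  rw [Matrix.mem_unitaryGroup_iff, Matrix.star_eq_conjTranspose] at *
  rw [Matrix.conjTranspose_submatrix, ← swap_mul, hM]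
  exact Matrix.submatrix_one_equiv (Equiv.prodComm (Fin dB) (Fin dA))

theorem IsLocalUnitary.swap {L : Matrix (Fin dA × Fin dB) (Fin dA × Fin dB) ℂ}
    (hL : IsLocalUnitary L) :
    IsLocalUnitary (L.submatrix (Prod.swap : Fin dB × Fin dA → _) Prod.swap) := by
  obtain ⟨X, Y, hX, hY, rfl⟩ := hL
  refine ⟨Y, X, hY, hX, ?_⟩
  ext p q
  exact mul_comm _ _

theorem IsStdGate.swap {G : Matrix (Fin dA × Fin dB) (Fin dA × Fin dB) ℂ} (hG : IsStdGate G) :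
    IsStdGate (G.submatrix (Prod.swap : Fin dB × Fin dA → _) Prod.swap) := by
  obtain ⟨hGu, a, b, ha, hb, hfix, A₁, B₁, A₂, B₂, h⟩ := hG
  refine ⟨swap_mem_unitaryGroup hGu, b, a, hb, ha, fun q hq p => ?_, B₁, A₁, B₂, A₂,
    fun p q => ?_⟩
  · rw [Matrix.submatrix_apply, hfix q.swap hq.symm]
    simp only [Prod.swap_inj]
  · refine (h p.swap q.swap).trans ?_
    exact congrArg₂ (fun x y : ℂ => x + y) (mul_comm _ _) (mul_comm _ _)

theorem IsCircuit.swap {k : ℕ} {M : Matrix (Fin dA × Fin dB) (Fin dA × Fin dB) ℂ}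
    (hM : IsCircuit k M) :
    IsCircuit k (M.submatrix (Prod.swap : Fin dB × Fin dA → _) Prod.swap) := by
  induction hM with
  | loc hL => exact .loc hL.swap
  | cons hL hG _ ih =>
    rw [swap_mul, swap_mul]
    exact .cons hL.swap hG.swap ih

theorem IsCircuit.exists_factors {k : ℕ} {M : Matrix (Fin dA × Fin dB) (Fin dA × Fin dB) ℂ}
    (hM : IsCircuit k M) :
    ∃ (L : Fin (k + 1) → Matrix (Fin dA × Fin dB) (Fin dA × Fin dB) ℂ)
      (G : Fin k → Matrix (Fin dA × Fin dB) (Fin dA × Fin dB) ℂ),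
      (∀ i, IsLocalUnitary (L i)) ∧ (∀ i, IsStdGate (G i)) ∧
      M = L 0 * (List.ofFn (fun i => G i * L i.succ)).prod := by
  induction hM with
  | @loc L hL => exact ⟨fun _ => L, Fin.elim0, fun _ => hL, fun i => i.elim0, by simp⟩
  | @cons k L₀ G₀ M hL hG _ ih =>
    obtain ⟨L, G, hLs, hGs, rfl⟩ := ih
    refine ⟨Fin.cons L₀ L, Fin.cons G₀ G, Fin.cases hL hLs, Fin.cases hG hGs, ?_⟩
    simp [List.ofFn_succ, Matrix.mul_assoc]

theorem ctrlFst_smul (e : Fin dA → ℂ) (W : Matrix (Fin dB) (Fin dB) ℂ) :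
    ctrlFst (fun a => e a • W) = Matrix.diagonal e ⊗ₖ W := by
  ext p q
  rw [ctrlFst_apply, Matrix.kronecker_apply, Matrix.diagonal_apply]
  by_cases h : p.1 = q.1 <;> simp [h]

theorem diagonal_mem_unitaryGroup {ι : Type*} [Fintype ι] [DecidableEq ι] {c : ι → ℂ}
    (hc : ∀ i, star (c i) * c i = 1) : Matrix.diagonal c ∈ Matrix.unitaryGroup ι ℂ := by
  rw [Matrix.mem_unitaryGroup_iff', Matrix.star_eq_conjTranspose, Matrix.diagonal_conjTranspose,
    Matrix.diagonal_mul_diagonal, ← Matrix.diagonal_one]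
  congr 1
  funext i
  exact hc i

theorem isLocalUnitary_ctrlFst_smul {e : Fin dA → ℂ} (he : ∀ a, star (e a) * e a = 1)
    {W : Matrix (Fin dB) (Fin dB) ℂ} (hW : W ∈ Matrix.unitaryGroup (Fin dB) ℂ) :
    IsLocalUnitary (ctrlFst fun a => e a • W) :=
  ⟨_, W, diagonal_mem_unitaryGroup he, hW, ctrlFst_smul e W⟩

theorem isLocalUnitary_ctrlFst_const {W : Matrix (Fin dB) (Fin dB) ℂ}
    (hW : W ∈ Matrix.unitaryGroup (Fin dB) ℂ) :
    IsLocalUnitary (ctrlFst fun _ : Fin dA => W) := by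
  have := isLocalUnitary_ctrlFst_smul (dA := dA) (e := 1) (by simp) hW
  simpa using this

theorem update_one_mem_unitaryGroup (a₀ : Fin dA) {V : Matrix (Fin dB) (Fin dB) ℂ}
    (hV : V ∈ Matrix.unitaryGroup (Fin dB) ℂ) (a : Fin dA) :
    Function.update (1 : Fin dA → Matrix (Fin dB) (Fin dB) ℂ) a₀ V a ∈ Matrix.unitaryGroup (Fin dB) ℂ := by
  by_cases h : a = a₀
  · subst h; simpa using hV
  · rw [Function.update_of_ne h]; exact one_mem _

theorem ctrlFst_update_mul (a₀ : Fin dA) (V W : Matrix (Fin dB) (Fin dB) ℂ) :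
    ctrlFst (Function.update 1 a₀ V) * ctrlFst (Function.update 1 a₀ W) =
      ctrlFst (Function.update 1 a₀ (V * W)) := by
  rw [ctrlFst_mul]
  congr 1
  funext a
  by_cases h : a = a₀
  · subst h; simp
  · simp [Function.update_of_ne h]

theorem isStdGate_ctrlFst_diagonal {a₀ a₁ : Fin dA} (ha : a₀ ≠ a₁) {x y : Fin dB} (hxy : x ≠ y)
    {c : Fin dB → ℂ} (hc : ∀ b, star (c b) * c b = 1) (h1 : ∀ b, b ≠ x → b ≠ y → c b = 1) :
    IsStdGate (ctrlFst (Function.update 1 a₀ (Matrix.diagonal c))) := by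
  refine ⟨(isCtrlFst_ctrlFst
    (update_one_mem_unitaryGroup a₀ (diagonal_mem_unitaryGroup hc))).1, ![a₀, a₁], ![x, y],
    ?_, ?_, ?_, !![1, 0; 0, 0], !![c x, 0; 0, c y], !![0, 0; 0, 1], 1, ?_⟩
  · intro i j h
    fin_cases i <;> fin_cases j <;> simp_all
  · intro i j h
    fin_cases i <;> fin_cases j <;> simp_all
  · rintro ⟨a, b⟩ hq ⟨a', b'⟩
    rw [ctrlFst_apply]
    simp only [Fin.forall_fin_two, Matrix.cons_val_zero, Matrix.cons_val_one] at hq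
    by_cases haa : a' = a
    · subst haa
      by_cases ha0 : a' = a₀
      · subst ha0
        have hb : c b = 1 := h1 b (by tauto) (by tauto)
        by_cases hbb : b' = b
        · subst hbb; simp [hb]
        · simp [hbb]
      · simp [Function.update_of_ne ha0, Matrix.one_apply]
    · simp [haa]
  · rintro ⟨i, j⟩ ⟨i', j'⟩
    rw [ctrlFst_apply]
    fin_cases i <;> fin_cases j <;> fin_cases i' <;> fin_cases j' <;>
      simp [ha, ha.symm, hxy, hxy.symm]

theorem isCircuit_ctrlFst_diagonal_of_support (hdA : 2 ≤ dA) (hdB : 2 ≤ dB) (a₀ : Fin dA)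
    (s : Finset (Fin dB)) : ∀ c : Fin dB → ℂ, (∀ b, star (c b) * c b = 1) →
      (∀ b, b ∉ s → c b = 1) →
      IsCircuit ((s.card + 1) / 2) (ctrlFst (Function.update 1 a₀ (Matrix.diagonal c))) := by
  have : Nontrivial (Fin dA) := Fin.nontrivial_iff_two_le.2 hdA
  have : Nontrivial (Fin dB) := Fin.nontrivial_iff_two_le.2 hdB
  induction s using Finset.strongInduction with
  | H s ih =>
    intro c hc hs
    rcases s.eq_empty_or_nonempty with rfl | ⟨x, hx⟩
    · have h1 : c = 1 := funext fun b => hs b (by simp)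
      have h2 : Function.update (1 : Fin dA → Matrix (Fin dB) (Fin dB) ℂ) a₀
          (Matrix.diagonal c) = fun _ => 1 := by
        rw [h1, show Matrix.diagonal (1 : Fin dB → ℂ) = (1 : Fin dA → Matrix (Fin dB) (Fin dB) ℂ) a₀
          from Matrix.diagonal_one, Function.update_eq_self]
        rfl
      rw [h2, ctrlFst_one]
      simpa using IsCircuit.loc (.one (dA := dA) (dB := dB))
    · obtain ⟨y, hyx, hcard⟩ : ∃ y, y ≠ x ∧
          (s.card + 1) / 2 = 1 + (((s.erase x).erase y).card + 1) / 2 := by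
        have hsx := Finset.card_erase_add_one hx
        rcases (s.erase x).eq_empty_or_nonempty with h | ⟨y, hy⟩
        · obtain ⟨y, hy⟩ := exists_ne x
          refine ⟨y, hy, ?_⟩
          rw [h] at hsx ⊢
          simp [← hsx]
        · refine ⟨y, Finset.ne_of_mem_erase hy, ?_⟩
          have := Finset.card_erase_add_one hy
          omega
      obtain ⟨a₁, ha⟩ := exists_ne a₀
      let c₁ : Fin dB → ℂ := fun b => if b = x ∨ b = y then c b else 1
      let c₂ : Fin dB → ℂ := fun b => if b = x ∨ b = y then 1 else c b
      have hprod : Matrix.diagonal c = Matrix.diagonal c₁ * Matrix.diagonal c₂ := by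
        rw [Matrix.diagonal_mul_diagonal]
        congr 1
        funext b
        by_cases hb : b = x ∨ b = y <;> simp [c₁, c₂, hb]
      rw [hprod, ← ctrlFst_update_mul, hcard]
      refine IsCircuit.mul (IsStdGate.isCircuit (isStdGate_ctrlFst_diagonal ha.symm hyx.symm
        (fun b => ?_) fun b hbx hby => ?_)) (ih _ ?_ c₂ (fun b => ?_) fun b hb => ?_)
      · by_cases hb : b = x ∨ b = y
        · simpa [c₁, hb] using hc b
        · simp [c₁, hb]
      · simp [c₁, hbx, hby]
      · exact (Finset.erase_subset _ _).trans_ssubset (Finset.erase_ssubset hx)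
      · by_cases hb : b = x ∨ b = y
        · simp [c₂, hb]
        · simpa [c₂, hb] using hc b
      · by_cases hbxy : b = x ∨ b = y
        · simp [c₂, hbxy]
        · simp only [c₂, hbxy, if_false]
          refine hs b fun h => hb ?_
          simp only [Finset.mem_erase]
          tauto

theorem isCircuit_ctrlFst_update (hdA : 2 ≤ dA) (hdB : 2 ≤ dB) (a₀ : Fin dA)
    {V : Matrix (Fin dB) (Fin dB) ℂ} (hV : V ∈ Matrix.unitaryGroup (Fin dB) ℂ) :
    IsCircuit (dB / 2) (ctrlFst (Function.update 1 a₀ V)) := by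
  obtain ⟨W, hW, c, hc, rfl⟩ := V.exists_unitary_diagonal hV
  let b₀ : Fin dB := ⟨0, by omega⟩
  let e : Fin dA → ℂ := Function.update 1 a₀ (c b₀)
  let c' : Fin dB → ℂ := fun b => star (c b₀) * c b
  have hc0 : c b₀ * star (c b₀) = 1 := by rw [mul_comm, hc]
  have hWW : W * Wᴴ = 1 := Matrix.mem_unitaryGroup_iff.1 hW
  have heq : ctrlFst (Function.update (1 : Fin dA → _) a₀ (W * Matrix.diagonal c * Wᴴ)) =
      ctrlFst (fun a => e a • W) * (ctrlFst (Function.update 1 a₀ (Matrix.diagonal c')) *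
        ctrlFst (fun _ => Wᴴ)) := by
    rw [ctrlFst_mul, ctrlFst_mul]
    congr 1
    funext a
    by_cases h : a = a₀
    · subst h
      have hcc : Matrix.diagonal c = c b₀ • Matrix.diagonal c' := by
        rw [← Matrix.diagonal_smul]
        congr 1
        funext b
        simp only [Pi.smul_apply, smul_eq_mul, c', ← mul_assoc, hc0, one_mul]
      simp [e, hcc, Matrix.mul_assoc]
    · simp [e, Function.update_of_ne h, hWW]
  have hcard : ((Finset.univ.erase b₀).card + 1) / 2 = dB / 2 := by
    rw [Finset.card_erase_add_one (Finset.mem_univ _), Finset.card_univ, Fintype.card_fin]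
  have h1 : IsCircuit 0 (ctrlFst fun a => e a • W) := by
    refine .loc (isLocalUnitary_ctrlFst_smul (fun a => ?_) hW)
    by_cases h : a = a₀
    · subst h; simpa [e] using hc b₀
    · simp [e, Function.update_of_ne h]
  have h2 := isCircuit_ctrlFst_diagonal_of_support hdA hdB a₀ (Finset.univ.erase b₀) c'
    (fun b => by
      simp only [c', star_mul, star_star]
      rw [show star (c b) * c b₀ * (star (c b₀) * c b) = (c b₀ * star (c b₀)) * (star (c b) * c b)
        by ring, hc0, hc, one_mul])
    (fun b hb => by
      have : b = b₀ := by simpa using hb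
      rw [this]
      exact hc b₀)
  have h3 : IsCircuit 0 (ctrlFst fun _ : Fin dA => Wᴴ) :=
    .loc (isLocalUnitary_ctrlFst_const (Unitary.star_mem hW))
  rw [hcard] at h2
  rw [heq]
  simpa using h1.mul (h2.mul h3)

theorem isCircuit_ctrlFst_of_support (hdA : 2 ≤ dA) (hdB : 2 ≤ dB) (s : Finset (Fin dA)) :
    ∀ V : Fin dA → Matrix (Fin dB) (Fin dB) ℂ, (∀ a, V a ∈ Matrix.unitaryGroup (Fin dB) ℂ) →
      (∀ a, a ∉ s → V a = 1) → IsCircuit (s.card * (dB / 2)) (ctrlFst V) := by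
  induction s using Finset.induction_on with
  | empty =>
    intro V _ hs
    rw [show V = fun _ => 1 from funext fun a => hs a (by simp), ctrlFst_one]
    simpa using IsCircuit.loc .one
  | insert a s ha ih =>
    intro V hV hs
    have heq : ctrlFst V =
        ctrlFst (Function.update 1 a (V a)) * ctrlFst (Function.update V a 1) := by
      rw [ctrlFst_mul]
      congr 1
      funext a'
      by_cases h : a' = a
      · subst h; simp
      · simp [Function.update_of_ne h]
    rw [heq, Finset.card_insert_of_notMem ha, add_mul, one_mul, add_comm]
    refine (isCircuit_ctrlFst_update hdA hdB a (hV a)).mul (ih _ (fun a' => ?_) fun a' ha' => ?_)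
    · by_cases h : a' = a
      · subst h; rw [Function.update_self]; exact one_mem _
      · rw [Function.update_of_ne h]; exact hV a'
    · by_cases h : a' = a
      · subst h; rw [Function.update_self]
      · rw [Function.update_of_ne h]
        exact hs a' (by simp [h, ha'])

theorem IsCtrlFst.exists_eq_ctrlFst {M : Matrix (Fin dA × Fin dB) (Fin dA × Fin dB) ℂ}
    (hM : IsCtrlFst M) : ∃ V : Fin dA → Matrix (Fin dB) (Fin dB) ℂ,
      (∀ a, V a ∈ Matrix.unitaryGroup (Fin dB) ℂ) ∧ M = ctrlFst V := by
  have hMV : M = ctrlFst fun a => M.submatrix (Prod.mk a) (Prod.mk a) := by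
    ext ⟨a, b⟩ ⟨a', b'⟩
    rw [ctrlFst_apply]
    by_cases h : a = a'
    · subst h; simp
    · rw [if_neg h]; exact hM.2 _ _ h
  refine ⟨_, fun a => ?_, hMV⟩
  have h := Matrix.mem_unitaryGroup_iff.1 hM.1
  rw [Matrix.star_eq_conjTranspose, hMV, ctrlFst_conjTranspose, ctrlFst_mul] at h
  rw [Matrix.mem_unitaryGroup_iff, Matrix.star_eq_conjTranspose]
  ext b b'
  have := congrFun (congrFun h (a, b)) (a, b')
  rw [ctrlFst_apply, if_pos rfl] at this
  refine this.trans ?_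
  simp [Matrix.one_apply]

theorem IsCtrlFst.isCircuit (hdA : 2 ≤ dA) (hdB : 2 ≤ dB)
    {M : Matrix (Fin dA × Fin dB) (Fin dA × Fin dB) ℂ} (hM : IsCtrlFst M) :
    IsCircuit ((dA - 1) * (dB / 2)) M := by
  obtain ⟨V, hV, rfl⟩ := hM.exists_eq_ctrlFst
  let a₀ : Fin dA := ⟨0, by omega⟩
  have h0 : (V a₀)ᴴ * V a₀ = 1 := Matrix.mem_unitaryGroup_iff'.1 (hV a₀)
  have h0' : V a₀ * (V a₀)ᴴ = 1 := Matrix.mem_unitaryGroup_iff.1 (hV a₀)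
  have heq : ctrlFst V = ctrlFst (fun _ => V a₀) * ctrlFst (fun a => (V a₀)ᴴ * V a) := by
    rw [ctrlFst_mul]
    congr 1
    funext a
    rw [← Matrix.mul_assoc, h0', Matrix.one_mul]
  have h1 : IsCircuit 0 (ctrlFst fun _ : Fin dA => V a₀) :=
    .loc (isLocalUnitary_ctrlFst_const (hV a₀))
  have h2 := isCircuit_ctrlFst_of_support hdA hdB (Finset.univ.erase a₀)
    (fun a => (V a₀)ᴴ * V a) (fun a => mul_mem (Unitary.star_mem (hV a₀)) (hV a)) (fun a ha => by
      have : a = a₀ := by simpa using ha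
      rw [this, h0])
  rw [Finset.card_erase_of_mem (Finset.mem_univ _), Finset.card_univ, Fintype.card_fin] at h2
  rw [heq]
  simpa using h1.mul h2

theorem IsCtrlSnd.isCircuit (hdA : 2 ≤ dA) (hdB : 2 ≤ dB)
    {M : Matrix (Fin dA × Fin dB) (Fin dA × Fin dB) ℂ} (hM : IsCtrlSnd M) :
    IsCircuit ((dB - 1) * (dA / 2)) M := by
  have h : IsCtrlFst (M.submatrix (Prod.swap : Fin dB × Fin dA → _) Prod.swap) :=
    ⟨swap_mem_unitaryGroup hM.1, fun p q hpq => hM.2 p.swap q.swap hpq⟩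
  exact (h.isCircuit hdB hdA).swap

theorem IsLayered.isCircuit (hdA : 2 ≤ dA) (hdB : 2 ≤ dB) {p s : ℕ}
    {M : Matrix (Fin dA × Fin dB) (Fin dA × Fin dB) ℂ} (hM : IsLayered p s M) :
    IsCircuit ((s + 1) * ((dA - 1) * (dB / 2)) + s * ((dB - 1) * (dA / 2))) M := by
  induction hM with
  | single ha _ => simpa using ha.isCircuit hdA hdB
  | @cons p s a b M ha _ hb _ _ ih =>
    have h := ((ha.isCircuit hdA hdB).mul (hb.isCircuit hdA hdB)).mul ih
    convert h using 1
    ring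

end Circuits

/-- Every bipartite unitary on the `d_A × d_B` system is the product of
`2 (d_A − 1)² ⌊d_B/2⌋ + (2 d_A − 3)(d_B − 1) ⌊d_A/2⌋` standard gates interspersed with
local unitaries. -/
theorem unitary_std_gates (dA dB : ℕ) (hdA : 2 ≤ dA) (hdB : 2 ≤ dB)
    (U : Matrix (Fin dA × Fin dB) (Fin dA × Fin dB) ℂ)
    (hU : U ∈ Matrix.unitaryGroup (Fin dA × Fin dB) ℂ) :
    ∃ (L : Fin (2 * (dA - 1) ^ 2 * (dB / 2) + (2 * dA - 3) * (dB - 1) * (dA / 2) + 1) →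
        Matrix (Fin dA × Fin dB) (Fin dA × Fin dB) ℂ)
      (G : Fin (2 * (dA - 1) ^ 2 * (dB / 2) + (2 * dA - 3) * (dB - 1) * (dA / 2)) →
        Matrix (Fin dA × Fin dB) (Fin dA × Fin dB) ℂ),
      (∀ i, IsLocalUnitary (L i)) ∧ (∀ i, IsStdGate (G i)) ∧
      U = L 0 * (List.ofFn (fun i => G i * L i.succ)).prod := by
  have hL : IsLayered 2 (2 * (dA - 2) + 1) U :=
    isLayered_of_actsOn (dA - 2) (by omega) hU fun p q h => by
      simp only [Set.mem_ofPred_eq] at h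
      omega
  have hC := hL.isCircuit hdA hdB
  have hcount : (2 * (dA - 2) + 1 + 1) * ((dA - 1) * (dB / 2)) +
      (2 * (dA - 2) + 1) * ((dB - 1) * (dA / 2)) =
      2 * (dA - 1) ^ 2 * (dB / 2) + (2 * dA - 3) * (dB - 1) * (dA / 2) := by
    rw [show 2 * (dA - 2) + 1 + 1 = 2 * (dA - 1) by omega,
      show 2 * (dA - 2) + 1 = 2 * dA - 3 by omega]
    ring
  rw [hcount] at hC
  exact hC.exists_factors
end
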